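/- arXiv:2112.09369 — 9 statements merged into one kernel-verified Lean document; each statement's English description precedes it below -/
import Mathlib

section
/- Let Φ(ρ) = ∑_ℓ K_ℓ ρ K_ℓ† be a trace-preserving map given in operator-sum form (∑_ℓ K_ℓ† K_ℓ = I) on complex square matrices indexed by Fin d_A × Fin d_B. If Φ is population-preserving, i.e. (Φ(ρ))_{(a,b),(a,b)} = ρ_{(a,b),(a,b)} for every density matrix ρ and every index (a,b), then every Kraus operator is diagonal: (K_ℓ)_{(a,b),(a',b')} = 0 whenever (a,b) ≠ (a',b'). -/
open Matrix BigOperators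
open scoped ComplexOrder

/-- If a trace-preserving map in operator-sum form on matrices indexed by
`Fin dA × Fin dB` is population-preserving (diagonal entries of density matrices are
unchanged), then every Kraus operator is diagonal. -/
theorem kraus_diagonal_of_population_preserving
    (dA dB : ℕ) (n : ℕ)
    (K : Fin n → Matrix (Fin dA × Fin dB) (Fin dA × Fin dB) ℂ)
    (Φ : Matrix (Fin dA × Fin dB) (Fin dA × Fin dB) ℂ →
         Matrix (Fin dA × Fin dB) (Fin dA × Fin dB) ℂ)
    (hΦ : ∀ ρ, Φ ρ = ∑ ℓ, K ℓ * ρ * (K ℓ)ᴴ)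
    (hTP : ∑ ℓ, (K ℓ)ᴴ * K ℓ = 1)
    (hPP : ∀ ρ : Matrix (Fin dA × Fin dB) (Fin dA × Fin dB) ℂ,
        ρ.PosSemidef → ρ.trace = 1 → ∀ i, (Φ ρ) i i = ρ i i) :
    ∀ (ℓ : Fin n) (i j : Fin dA × Fin dB), i ≠ j → K ℓ i j = 0 := by
  intro ℓ i j hij
  have h := hPP (Matrix.diagonal (Pi.single j 1))
    (Matrix.PosSemidef.diagonal (by
      intro k
      by_cases hk : k = j
      · subst hk; simp
      · simp [hk]))
    (by simp [Matrix.trace_diagonal]) i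
  rw [hΦ, Matrix.sum_apply] at h
  have e : ∀ l, (K l * Matrix.diagonal (Pi.single j (1 : ℂ)) * (K l)ᴴ : Matrix (Fin dA × Fin dB) (Fin dA × Fin dB) ℂ) i i
      = K l i j * star (K l i j) := by
    intro l
    rw [Matrix.mul_apply, Finset.sum_eq_single j]
    · simp [Matrix.mul_diagonal]
    · intro b _ hb
      simp [Matrix.mul_diagonal, hb]
    · simp
  simp only [e, Matrix.diagonal_apply_eq, Pi.single_eq_of_ne hij] at h
  rw [Finset.sum_eq_zero_iff_of_nonneg (fun l _ => mul_star_self_nonneg _)] at h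
  simpa using h ℓ (Finset.mem_univ _)
end

section
/- (Theorem 1.) A linear map Φ on complex square matrices indexed by Fin d_A × Fin d_B is CPTP (i.e. admits a Kraus representation Φ(ρ) = ∑_ℓ K_ℓ ρ K_ℓ† with ∑_ℓ K_ℓ† K_ℓ = I) and population-preserving if and only if there exists a positive semidefinite complex matrix E indexed by Fin d_A × Fin d_B with all diagonal entries E_{(a,b),(a,b)} = 1 such that Φ(ρ) = E ∘ ρ (the entrywise Hadamard product) for every matrix ρ. -/
open Matrix BigOperators
open scoped ComplexOrder

/-- Theorem 1: A map `Φ` on complex square matrices indexed by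
`Fin dA × Fin dB` is CPTP (admits a Kraus representation with `∑ Kᴴ K = 1`) and
population-preserving if and only if there is a positive semidefinite matrix `E`
with unit diagonal such that `Φ ρ = E ⊙ ρ` (Hadamard product) for every `ρ`. -/
theorem cptp_population_preserving_iff_hadamard
    (dA dB : ℕ)
    (Φ : Matrix (Fin dA × Fin dB) (Fin dA × Fin dB) ℂ →
         Matrix (Fin dA × Fin dB) (Fin dA × Fin dB) ℂ) :
    ((∃ (n : ℕ) (K : Fin n → Matrix (Fin dA × Fin dB) (Fin dA × Fin dB) ℂ),
        (∀ ρ, Φ ρ = ∑ ℓ, K ℓ * ρ * (K ℓ)ᴴ) ∧ ∑ ℓ, (K ℓ)ᴴ * K ℓ = 1) ∧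
      (∀ ρ : Matrix (Fin dA × Fin dB) (Fin dA × Fin dB) ℂ,
        ρ.PosSemidef → ρ.trace = 1 → ∀ i, (Φ ρ) i i = ρ i i))
    ↔ (∃ E : Matrix (Fin dA × Fin dB) (Fin dA × Fin dB) ℂ,
        E.PosSemidef ∧ (∀ i, E i i = 1) ∧ ∀ ρ, Φ ρ = E ⊙ ρ) := by
  constructor
  · rintro ⟨⟨n, K, hK, hK1⟩, hpop⟩
    have hoff : ∀ i j, i ≠ j → ∀ ℓ, K ℓ i j = 0 := by
      intro i j hij
      have hv : (Matrix.vecMulVec (Pi.single j (1 : ℂ)) (star (Pi.single j (1 : ℂ)))).PosSemidef :=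
        Matrix.posSemidef_vecMulVec_self_star _
      have hs : Matrix.vecMulVec (Pi.single j (1 : ℂ)) (star (Pi.single j (1 : ℂ)))
          = Matrix.single j j (1 : ℂ) := by
        ext a b
        by_cases ha : a = j <;> by_cases hb : b = j <;>
          simp [Matrix.vecMulVec_apply, Matrix.single_apply, ha, hb, Ne.symm, eq_comm (a := j)]
      rw [hs] at hv
      have h := hpop _ hv (by simp) i
      rw [hK, Matrix.sum_apply] at h
      have h2 : ∀ ℓ, (K ℓ * Matrix.single j j (1 : ℂ) * (K ℓ)ᴴ) i i
          = ((Complex.normSq (K ℓ i j) : ℝ) : ℂ) := by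
        intro ℓ
        rw [← Complex.mul_conj]
        simp [Matrix.mul_apply, Matrix.single_apply, Finset.sum_ite_eq, ite_and]
      simp only [h2] at h
      rw [Matrix.single_apply_of_ne _ _ _ _ _ (by tauto), ← Complex.ofReal_sum,
        Complex.ofReal_eq_zero, Finset.sum_eq_zero_iff_of_nonneg
          (fun _ _ => Complex.normSq_nonneg _)] at h
      intro ℓ
      exact Complex.normSq_eq_zero.mp (h ℓ (Finset.mem_univ _))
    have hd : ∀ ℓ, K ℓ = Matrix.diagonal (fun i => K ℓ i i) := by
      intro ℓ
      ext i j
      by_cases hij : i = j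
      · subst hij; simp
      · simp [hij, hoff i j hij ℓ]
    refine ⟨∑ ℓ, Matrix.vecMulVec (fun i => K ℓ i i) (star (fun i => K ℓ i i)),
      Matrix.posSemidef_sum _ (fun ℓ _ => Matrix.posSemidef_vecMulVec_self_star _), ?_, ?_⟩
    · intro i
      have h := congrFun (congrFun hK1 i) i
      rw [Matrix.sum_apply, Matrix.one_apply_eq] at h
      rw [Matrix.sum_apply, ← h]
      refine Finset.sum_congr rfl fun ℓ _ => ?_
      rw [hd ℓ]
      simp [Matrix.vecMulVec_apply, Matrix.diagonal_conjTranspose, mul_comm]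
    · intro ρ
      ext i j
      rw [hK, Matrix.hadamard_apply, Matrix.sum_apply, Matrix.sum_apply, Finset.sum_mul]
      refine Finset.sum_congr rfl fun ℓ _ => ?_
      rw [hd ℓ]
      simp [Matrix.vecMulVec_apply, Matrix.diagonal_conjTranspose]
      ring
  · rintro ⟨E, hE, hE1, hΦ⟩
    obtain ⟨B, hB⟩ : ∃ B : Matrix (Fin dA × Fin dB) (Fin dA × Fin dB) ℂ, E = Bᴴ * B := by
      open scoped MatrixOrder Matrix.Norms.L2Operator in
      exact CStarAlgebra.nonneg_iff_eq_star_mul_self.mp hE.nonneg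
    have hent : ∀ i j, E i j = ∑ ℓ : Fin (dA * dB),
        star (B (finProdFinEquiv.symm ℓ) i) * B (finProdFinEquiv.symm ℓ) j := by
      intro i j
      rw [hB, Matrix.mul_apply, ← finProdFinEquiv.symm.sum_comp]
      rfl
    refine ⟨⟨dA * dB, fun ℓ => Matrix.diagonal
      (fun i => star (B (finProdFinEquiv.symm ℓ) i)), ?_, ?_⟩, ?_⟩
    · intro ρ
      ext i j
      rw [hΦ, Matrix.hadamard_apply, Matrix.sum_apply, hent, Finset.sum_mul]
      refine Finset.sum_congr rfl fun ℓ _ => ?_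
      simp [Matrix.diagonal_conjTranspose]
      ring
    · ext i j
      rw [Matrix.sum_apply]
      by_cases hij : i = j
      · subst hij
        rw [Matrix.one_apply_eq, ← hE1 i, hent]
        refine Finset.sum_congr rfl fun ℓ _ => ?_
        simp [Matrix.diagonal_conjTranspose, mul_comm]
      · simp [Matrix.diagonal_conjTranspose, hij]
    · intro ρ _ _ i
      simp [hΦ, hE1]
end

section
/- (Theorem 2, operation separability.) A CPTP map Φ on complex square matrices indexed by Fin d_A × Fin d_B is a separable operation (i.e. admits a Kraus representation in which every Kraus operator is a Kronecker product A_ℓ ⊗ B_ℓ) if and only if its Choi matrix C = ∑_{(c,d),(c',d')} Φ(e_{(c,d),(c',d')}) ⊗ e_{(c,d),(c',d')}, regarded after the index regrouping ((a,b),(c,d)) ↦ ((a,c),(b,d)) as a matrix on (Fin d_A × Fin d_A) × (Fin d_B × Fin d_B), is separable, i.e. can be written as a finite sum ∑_k P_k ⊗ Q_k of Kronecker products of positive semidefinite matrices P_k (indexed by Fin d_A × Fin d_A) and Q_k (indexed by Fin d_B × Fin d_B). -/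
open Matrix BigOperators Kronecker
open scoped ComplexOrder

/-- The Choi matrix of a linear map `Φ` on matrices indexed by `I`:
`∑ i j, Φ (e_{i,j}) ⊗ₖ e_{i,j}`. -/
noncomputable def choiMatrix {I : Type*} [Fintype I] [DecidableEq I]
    (Φ : Matrix I I ℂ → Matrix I I ℂ) : Matrix (I × I) (I × I) ℂ :=
  ∑ i : I, ∑ j : I, (Φ (single i j 1)) ⊗ₖ (single i j 1)

/-- Regrouping of indices `((a,b),(c,d)) ↦ ((a,c),(b,d))`. -/
def regroup {dA dB : ℕ}
    (C : Matrix ((Fin dA × Fin dB) × (Fin dA × Fin dB))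
                ((Fin dA × Fin dB) × (Fin dA × Fin dB)) ℂ) :
    Matrix ((Fin dA × Fin dA) × (Fin dB × Fin dB))
           ((Fin dA × Fin dA) × (Fin dB × Fin dB)) ℂ :=
  fun x y => C ((x.1.1, x.2.1), (x.1.2, x.2.2)) ((y.1.1, y.2.1), (y.1.2, y.2.2))

/-- A matrix on a product index set is separable if it is a finite sum of Kronecker
products of positive semidefinite matrices. -/
def MatrixSeparable {α β : Type*} [Fintype α] [Fintype β] [DecidableEq α] [DecidableEq β]
    (M : Matrix (α × β) (α × β) ℂ) : Prop :=
  ∃ (n : ℕ) (P : Fin n → Matrix α α ℂ) (Q : Fin n → Matrix β β ℂ),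
    (∀ k, (P k).PosSemidef) ∧ (∀ k, (Q k).PosSemidef) ∧ M = ∑ k, P k ⊗ₖ Q k

/-- `Φ` is a separable operation: it admits a Kraus representation in which every
Kraus operator is a Kronecker product `A ℓ ⊗ₖ B ℓ`. -/
def IsSeparableOperation {dA dB : ℕ}
    (Φ : Matrix (Fin dA × Fin dB) (Fin dA × Fin dB) ℂ →
         Matrix (Fin dA × Fin dB) (Fin dA × Fin dB) ℂ) : Prop :=
  ∃ (n : ℕ) (A : Fin n → Matrix (Fin dA) (Fin dA) ℂ)
    (B : Fin n → Matrix (Fin dB) (Fin dB) ℂ),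
    (∀ ρ, Φ ρ = ∑ ℓ, (A ℓ ⊗ₖ B ℓ) * ρ * (A ℓ ⊗ₖ B ℓ)ᴴ) ∧
    ∑ ℓ, (A ℓ ⊗ₖ B ℓ)ᴴ * (A ℓ ⊗ₖ B ℓ) = 1

theorem choi_aux_entry {I : Type*} [Fintype I] [DecidableEq I]
    (Φ : Matrix I I ℂ → Matrix I I ℂ) (i k j l : I) :
    choiMatrix Φ (i, k) (j, l) = Φ (single k l 1) i j := by
  simp only [choiMatrix, Matrix.sum_apply, kroneckerMap_apply]
  rw [Finset.sum_eq_single k, Finset.sum_eq_single l]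
  · simp
  · intro b _ hb
    simp [hb]
  · simp
  · intro b _ hb
    simp [hb]
  · simp

theorem choi_aux_kraus {I : Type*} [Fintype I] (K ρ : Matrix I I ℂ) (i j : I) :
    (K * ρ * Kᴴ) i j = ∑ k, ∑ l, ρ k l * (K i k * star (K j l)) := by
  simp only [Matrix.mul_apply, conjTranspose_apply, Finset.sum_mul]
  rw [Finset.sum_comm]
  refine Finset.sum_congr rfl fun k _ => Finset.sum_congr rfl fun l _ => ?_
  ring

theorem choi_aux_single {I : Type*} [Fintype I] [DecidableEq I] (K : Matrix I I ℂ)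
    (i k j l : I) :
    (K * (single k l 1 : Matrix I I ℂ) * Kᴴ) i j = K i k * star (K j l) := by
  rw [choi_aux_kraus, Finset.sum_eq_single k, Finset.sum_eq_single l]
  · simp
  · intro b _ hb
    simp [hb.symm]
  · simp
  · intro b _ hb
    simp [hb.symm]
  · simp

theorem choi_aux_transfer {I ι κ : Type*} [Fintype I] [DecidableEq I] [Fintype ι] [Fintype κ]
    (K : ι → Matrix I I ℂ) (L : κ → Matrix I I ℂ)
    (h : ∀ i k j l, ∑ x, K x i k * star (K x j l) = ∑ x, L x i k * star (L x j l)) :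
    (∀ ρ, ∑ x, K x * ρ * (K x)ᴴ = ∑ x, L x * ρ * (L x)ᴴ) ∧
    ∑ x, (K x)ᴴ * K x = ∑ x, (L x)ᴴ * L x := by
  constructor
  · intro ρ
    ext i j
    simp only [Matrix.sum_apply, choi_aux_kraus]
    rw [Finset.sum_comm, Finset.sum_comm (s := (Finset.univ : Finset κ))]
    refine Finset.sum_congr rfl fun k _ => ?_
    rw [Finset.sum_comm, Finset.sum_comm (s := (Finset.univ : Finset κ))]
    refine Finset.sum_congr rfl fun l _ => ?_
    rw [← Finset.mul_sum, ← Finset.mul_sum, h]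
  · ext k l
    simp only [Matrix.sum_apply, Matrix.mul_apply, conjTranspose_apply]
    rw [Finset.sum_comm, Finset.sum_comm (s := (Finset.univ : Finset κ))]
    refine Finset.sum_congr rfl fun i _ => ?_
    simpa only [mul_comm] using h i l i k

open scoped MatrixOrder Matrix.Norms.L2Operator in
theorem choi_aux_psd {α : Type*} [Fintype α] [DecidableEq α] {M : Matrix α α ℂ}
    (h : M.PosSemidef) : ∃ v : α → α → ℂ, ∀ x y, M x y = ∑ m, v m x * star (v m y) := by
  obtain ⟨B, rfl⟩ := CStarAlgebra.nonneg_iff_eq_star_mul_self.mp h.nonneg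
  refine ⟨fun m x => star (B m x), fun x y => ?_⟩
  simp [Matrix.mul_apply, star_eq_conjTranspose]

/-- Theorem 2, operation separability: A CPTP map `Φ` is a separable
operation if and only if its regrouped Choi matrix is separable with respect to
the `AA'`/`BB'` split. -/
theorem separable_operation_iff_choi_separable
    (dA dB : ℕ)
    (Φ : Matrix (Fin dA × Fin dB) (Fin dA × Fin dB) ℂ →
         Matrix (Fin dA × Fin dB) (Fin dA × Fin dB) ℂ)
    (hCPTP : ∃ (n : ℕ) (K : Fin n → Matrix (Fin dA × Fin dB) (Fin dA × Fin dB) ℂ),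
        (∀ ρ, Φ ρ = ∑ ℓ, K ℓ * ρ * (K ℓ)ᴴ) ∧ ∑ ℓ, (K ℓ)ᴴ * K ℓ = 1) :
    IsSeparableOperation Φ ↔ MatrixSeparable (regroup (choiMatrix Φ)) := by
  obtain ⟨n, K, hK, hK1⟩ := hCPTP
  constructor
  · rintro ⟨m, A, B, hAB, -⟩
    refine ⟨m, fun ℓ => vecMulVec (fun x : Fin dA × Fin dA => A ℓ x.1 x.2)
        (star fun x : Fin dA × Fin dA => A ℓ x.1 x.2),
      fun ℓ => vecMulVec (fun x : Fin dB × Fin dB => B ℓ x.1 x.2)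
        (star fun x : Fin dB × Fin dB => B ℓ x.1 x.2),
      fun ℓ => posSemidef_vecMulVec_self_star _, fun ℓ => posSemidef_vecMulVec_self_star _, ?_⟩
    ext ⟨⟨a, c⟩, ⟨b, d⟩⟩ ⟨⟨a', c'⟩, ⟨b', d'⟩⟩
    simp only [regroup, choi_aux_entry, hAB, Matrix.sum_apply, choi_aux_single,
      kroneckerMap_apply, vecMulVec_apply, Pi.star_apply, star_mul']
    refine Finset.sum_congr rfl fun ℓ _ => ?_
    ring
  · rintro ⟨m, P, Q, hP, hQ, hC⟩
    choose v hv using fun k => choi_aux_psd (hP k)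
    choose w hw using fun k => choi_aux_psd (hQ k)
    let ι := Fin m × (Fin dA × Fin dA) × (Fin dB × Fin dB)
    let A : ι → Matrix (Fin dA) (Fin dA) ℂ := fun t a c => v t.1 t.2.1 (a, c)
    let B : ι → Matrix (Fin dB) (Fin dB) ℂ := fun t b d => w t.1 t.2.2 (b, d)
    let e : Fin (Fintype.card ι) ≃ ι := (Fintype.equivFin ι).symm
    have h : ∀ i k j l, ∑ x, K x i k * star (K x j l) =
        ∑ x, (A (e x) ⊗ₖ B (e x)) i k * star ((A (e x) ⊗ₖ B (e x)) j l) := by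
      rintro ⟨a, b⟩ ⟨c, d⟩ ⟨a', b'⟩ ⟨c', d'⟩
      have h1 := congrFun (congrFun hC ((a, c), (b, d))) ((a', c'), (b', d'))
      simp only [regroup, choi_aux_entry, hK, Matrix.sum_apply, choi_aux_single,
        kroneckerMap_apply, hv, hw] at h1
      rw [h1, Equiv.sum_comp e (fun t => (A t ⊗ₖ B t) (a, b) (c, d) *
        star ((A t ⊗ₖ B t) (a', b') (c', d'))), Fintype.sum_prod_type]
      refine Finset.sum_congr rfl fun k _ => ?_
      rw [Finset.sum_mul_sum, ← Finset.sum_product', Finset.univ_product_univ]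
      refine Finset.sum_congr rfl fun x _ => ?_
      rw [kroneckerMap_apply, kroneckerMap_apply, star_mul']
      simp only [A, B]
      ring
    obtain ⟨h1, h2⟩ := choi_aux_transfer K (fun x => A (e x) ⊗ₖ B (e x)) h
    exact ⟨_, fun x => A (e x), fun x => B (e x), fun ρ => (hK ρ).trans (h1 ρ),
      h2.symm.trans hK1⟩
end

section
/- (Theorem 3.) Let E be a positive semidefinite complex matrix indexed by Fin d_A × Fin d_B with all diagonal entries equal to 1, and let Φ(ρ) = E ∘ ρ be the corresponding population-preserving CPTP map. Then Φ is a separable operation (admits a Kraus representation with all Kraus operators of Kronecker-product form A_ℓ ⊗ B_ℓ) if and only if E is separable, i.e. there exist finitely many nonnegative reals λ_k and positive semidefinite matrices A_k (d_A×d_A) and B_k (d_B×d_B) such that E_{(a,b),(a',b')} = ∑_k λ_k (A_k)_{a,a'} (B_k)_{b,b'} for all indices. -/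
open Matrix BigOperators Kronecker
open scoped ComplexOrder

section
open scoped MatrixOrder Matrix.Norms.L2Operator
theorem psd_factor_aux {d : ℕ} {M : Matrix (Fin d) (Fin d) ℂ} (h : M.PosSemidef) :
    ∃ C : Matrix (Fin d) (Fin d) ℂ, M = star C * C :=
  CStarAlgebra.nonneg_iff_eq_star_mul_self.mp h.nonneg
end

/-- Theorem 3: For `E` positive semidefinite with unit diagonal, the
population-preserving CPTP map `Φ ρ = E ⊙ ρ` is a separable operation if and only
if `E` has the separable form
`E_{(a,b),(a',b')} = ∑ k, λ k * (A k)_{a,a'} * (B k)_{b,b'}`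
with `λ k ≥ 0` and `A k`, `B k` positive semidefinite. -/
theorem schur_multiplier_separable_operation_iff_E_separable
    (dA dB : ℕ)
    (E : Matrix (Fin dA × Fin dB) (Fin dA × Fin dB) ℂ)
    (hE : E.PosSemidef) (hdiag : ∀ i, E i i = 1) :
    IsSeparableOperation (fun ρ : Matrix (Fin dA × Fin dB) (Fin dA × Fin dB) ℂ => E ⊙ ρ)
    ↔ ∃ (n : ℕ) (lam : Fin n → ℝ) (A : Fin n → Matrix (Fin dA) (Fin dA) ℂ)
        (B : Fin n → Matrix (Fin dB) (Fin dB) ℂ),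
        (∀ k, 0 ≤ lam k) ∧ (∀ k, (A k).PosSemidef) ∧ (∀ k, (B k).PosSemidef) ∧
        ∀ (a a' : Fin dA) (b b' : Fin dB),
          E (a, b) (a', b') = ∑ k, (lam k : ℂ) * A k a a' * B k b b' := by
  constructor
  · rintro ⟨n, A, B, h, -⟩
    refine ⟨n, fun _ => 1, fun k => vecMulVec (fun a => A k a a) (star fun a => A k a a),
      fun k => vecMulVec (fun b => B k b b) (star fun b => B k b b), fun _ => zero_le_one,
      fun k => posSemidef_vecMulVec_self_star _, fun k => posSemidef_vecMulVec_self_star _, ?_⟩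
    intro a a' b b'
    have h1 := congrFun (congrFun (h (Matrix.single (a, b) (a', b') 1)) (a, b)) (a', b')
    simp only [Matrix.hadamard_apply, Matrix.single_apply_same, mul_one, Matrix.sum_apply] at h1
    rw [h1]
    refine Finset.sum_congr rfl fun k _ => ?_
    rw [Matrix.mul_apply, Finset.sum_eq_single (a', b')]
    · rw [Matrix.mul_single_apply_same]
      simp [vecMulVec_apply]
      ring
    · intro j _ hj
      rw [Matrix.mul_single_apply_of_ne _ _ _ _ _ hj]
      simp
    · simp
  · rintro ⟨n, lam, A, B, hl, hA, hB, h⟩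
    choose C hC using fun k => psd_factor_aux (hA k)
    choose D hD using fun k => psd_factor_aux (hB k)
    let e := (Fintype.equivFin (Fin n × Fin dA × Fin dB)).symm
    let u : Fin n × Fin dA × Fin dB → Fin dA → ℂ :=
      fun x a => (Real.sqrt (lam x.1) : ℂ) * star (C x.1 x.2.1 a)
    let v : Fin n × Fin dA × Fin dB → Fin dB → ℂ := fun x b => star (D x.1 x.2.2 b)
    have key : ∀ i j : Fin dA × Fin dB, E i j =
        ∑ x, (u x i.1 * v x i.2) * star (u x j.1 * v x j.2) := by
      rintro ⟨a, b⟩ ⟨a', b'⟩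
      rw [h, Fintype.sum_prod_type]
      refine Finset.sum_congr rfl fun k _ => ?_
      rw [Fintype.sum_prod_type, hC, hD]
      have hs : (lam k : ℂ) = (Real.sqrt (lam k) : ℂ) * (Real.sqrt (lam k) : ℂ) := by
        rw [← Complex.ofReal_mul, Real.mul_self_sqrt (hl k)]
      simp only [Matrix.star_eq_conjTranspose, Matrix.mul_apply, Matrix.conjTranspose_apply]
      rw [mul_assoc, Finset.sum_mul_sum, Finset.mul_sum]
      refine Finset.sum_congr rfl fun p _ => ?_
      rw [Finset.mul_sum]
      refine Finset.sum_congr rfl fun q _ => ?_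
      simp only [u, v, hs, star_mul', star_star, Complex.star_def, Complex.conj_ofReal,
        Complex.conj_conj]
      ring
    have hk : ∀ x, (diagonal (u x) ⊗ₖ diagonal (v x)) =
        diagonal fun i : Fin dA × Fin dB => u x i.1 * v x i.2 := fun x =>
      Matrix.diagonal_kronecker_diagonal _ _
    refine ⟨_, fun l => diagonal (u (e l)), fun l => diagonal (v (e l)), ?_, ?_⟩
    · intro ρ
      rw [e.sum_comp fun x => (diagonal (u x) ⊗ₖ diagonal (v x)) * ρ *
        (diagonal (u x) ⊗ₖ diagonal (v x))ᴴ]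
      ext i j
      simp only [hk, Matrix.hadamard_apply, Matrix.sum_apply, diagonal_conjTranspose,
        Matrix.mul_diagonal, Matrix.diagonal_mul]
      rw [key, Finset.sum_mul]
      refine Finset.sum_congr rfl fun x _ => ?_
      simp only [Pi.star_apply]
      ring
    · rw [e.sum_comp fun x => (diagonal (u x) ⊗ₖ diagonal (v x))ᴴ *
        (diagonal (u x) ⊗ₖ diagonal (v x))]
      ext i j
      simp only [hk, Matrix.sum_apply, diagonal_conjTranspose, Matrix.diagonal_mul_diagonal]
      by_cases hij : i = j
      · subst hij
        rw [Matrix.one_apply_eq, ← hdiag i, key]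
        refine Finset.sum_congr rfl fun x _ => ?_
        rw [Matrix.diagonal_apply_eq, Pi.star_apply, mul_comm]
      · simp [hij]
end

section
/- (Corollary 1.) Let d_A · d_B ≤ 6, let E be a positive semidefinite complex matrix indexed by Fin d_A × Fin d_B with all diagonal entries equal to 1, and let Φ(ρ) = E ∘ ρ be the corresponding population-preserving CPTP map. Then Φ is a separable operation if and only if the partial transpose E^{T_A}, defined by (E^{T_A})_{(a,b),(a',b')} = E_{(a',b),(a,b')}, is positive semidefinite. -/
open Matrix BigOperators Kronecker
open scoped ComplexOrder

/-- Partial transpose on the first factor: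
`(M^{T_A})_{(a,b),(a',b')} = M_{(a',b),(a,b')}`. -/
def partialTransposeA {dA dB : ℕ}
    (M : Matrix (Fin dA × Fin dB) (Fin dA × Fin dB) ℂ) :
    Matrix (Fin dA × Fin dB) (Fin dA × Fin dB) ℂ :=
  fun i j => M (j.1, i.2) (i.1, j.2)

namespace SW

/-- No nonvanishing continuous function on the plane is odd on the unit circle. -/
theorem no_odd (ψ : ℂ → ℂ) (hc : Continuous ψ) (h0 : ∀ x, ψ x ≠ 0)
    (hodd : ∀ x : ℂ, ‖x‖ = 1 → ψ (-x) = - ψ x) : False := by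
  obtain ⟨F, ⟨-, hF⟩, -⟩ := Complex.isCoveringMapOn_exp.existsUnique_continuousMap_lifts
    (⟨ψ, hc⟩ : C(ℂ, ℂ)) (a₀ := 0) (e₀ := Complex.log (ψ 0)) (Complex.exp_log (h0 0))
    (fun a => h0 a)
  have hF' : ∀ x, Complex.exp (F x) = ψ x := fun x => congrFun hF x
  let m : ℝ → ℂ := fun θ => F (Complex.exp (θ * Complex.I)) - F (-Complex.exp (θ * Complex.I))
  have hm : Continuous m := by fun_prop
  have hexp : ∀ θ, Complex.exp (m θ) = -1 := by
    intro θ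
    simp only [m, Complex.exp_sub, hF']
    rw [hodd _ (by simp [Complex.norm_exp])]
    have := h0 (Complex.exp (θ * Complex.I))
    field_simp
  have hint : ∀ θ, ∃ n : ℤ, (m θ).im = Real.pi * (2 * n + 1) := by
    intro θ
    have h1 : Complex.exp (m θ) = Complex.exp (Real.pi * Complex.I) := by
      rw [hexp, Complex.exp_pi_mul_I]
    obtain ⟨n, hn⟩ := Complex.exp_eq_exp_iff_exists_int.1 h1
    refine ⟨n, ?_⟩
    rw [hn]; simp; ring
  have hmpi : m Real.pi = - m 0 := by
    simp only [m, Complex.exp_pi_mul_I]; simp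
  have hpi := Real.pi_pos
  -- intermediate value: the imaginary part vanishes somewhere
  have hz : ∃ θ, (m θ).im = 0 := by
    have hmi : Continuous fun θ => (m θ).im := by fun_prop
    have h1 := mem_range_of_exists_le_of_exists_ge hmi (c := 0)
    rcases le_total (m 0).im 0 with h | h
    · exact h1 ⟨0, h⟩ ⟨Real.pi, by rw [hmpi]; simpa using h⟩
    · exact h1 ⟨Real.pi, by rw [hmpi]; simpa using h⟩ ⟨0, h⟩
  obtain ⟨θ, hθ⟩ := hz
  obtain ⟨n, hn⟩ := hint θ
  rw [hθ] at hn
  have h2 : (2 * (n : ℝ) + 1) = 0 := by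
    rcases mul_eq_zero.1 hn.symm with h | h
    · exact absurd h hpi.ne'
    · exact h
  have h3 : (2 * n + 1 : ℤ) = 0 := by exact_mod_cast h2
  omega

/-- If `P` is idempotent, the pencil `G - w P - conj w (1-P)` in odd dimension is singular somewhere. -/
theorem exists_singular (G P : Matrix (Fin 3) (Fin 3) ℂ) (hP : P * P = P) :
    ∃ w : ℂ, (G - (w • P + star w • (1 - P))).det = 0 := by
  by_contra! hne
  let Z : ℂ → Matrix (Fin 3) (Fin 3) ℂ := fun x => x • P + star x • (1 - P)
  have hPQ : P * (1 - P) = 0 := by rw [mul_sub, hP]; simp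
  have hQP : (1 - P) * P = 0 := by rw [sub_mul, hP]; simp
  have hQQ : (1 - P) * (1 - P) = 1 - P := by rw [mul_sub, hQP]; simp
  have hZ0 : ∀ x, x ≠ 0 → (Z x).det ≠ 0 := by
    intro x hx hd
    have : Z x * (x⁻¹ • P + (star x)⁻¹ • (1 - P)) = 1 := by
      have hx' : star x ≠ 0 := by simpa using hx
      simp only [Z, add_mul, mul_add, smul_mul_assoc, mul_smul_comm, hP, hPQ, hQP, hQQ]
      simp only [smul_zero, add_zero, zero_add, smul_smul]
      rw [inv_mul_cancel₀ hx, inv_mul_cancel₀ hx']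
      simp
    have h2 := congrArg Matrix.det this
    rw [Matrix.det_mul, hd] at h2
    simp at h2
  let ψ : ℂ → ℂ := fun x => (((max 0 (1 - ‖x‖) : ℝ) : ℂ) • G - Z x).det
  refine no_odd ψ ?_ ?_ ?_
  · have : Continuous fun x => (((max 0 (1 - ‖x‖) : ℝ) : ℂ) • G - Z x) := by
      simp only [Z]; fun_prop
    exact this.matrix_det
  · intro x
    simp only [ψ]
    rcases lt_or_ge ‖x‖ 1 with h | h
    · rw [max_eq_right (by linarith)]
      set r : ℝ := 1 - ‖x‖ with hr
      have hr0 : (r : ℂ) ≠ 0 := by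
        have : r ≠ 0 := by rw [hr]; linarith
        exact_mod_cast this
      have : ((r : ℂ) • G - Z x) = (r : ℂ) • (G - (((r : ℂ)⁻¹ * x) • P + star ((r : ℂ)⁻¹ * x) • (1 - P))) := by
        simp only [Z, smul_sub, smul_add, smul_smul]
        have e1 : (r : ℂ) * ((r : ℂ)⁻¹ * x) = x := mul_inv_cancel_left₀ hr0 x
        have e2 : (r : ℂ) * star ((r : ℂ)⁻¹ * x) = star x := by
          simp [mul_inv_cancel_left₀ hr0]
        rw [e1, e2]
      rw [this, Matrix.det_smul]
      exact mul_ne_zero (pow_ne_zero _ hr0) (hne _)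
    · rw [max_eq_left (by linarith)]
      simp only [Complex.ofReal_zero, zero_smul, zero_sub, Matrix.det_neg]
      refine mul_ne_zero (by simp) (hZ0 x ?_)
      intro h0; simp [h0] at h; linarith
  · intro x hx
    have : Z (-x) = - Z x := by simp only [Z, star_neg, neg_smul]; abel
    simp only [ψ, norm_neg, hx, this]
    simp [Matrix.det_neg]
    ring

/-- The nonsingular commutator case: a product vector from the degree argument. -/
theorem pv_nonsing (B D1 D2 : Matrix (Fin 3) (Fin 3) ℂ)
    (hdet : IsUnit (D2 - D1).det)
    (hdisj : ∀ x y, D1 *ᵥ x = D2 *ᵥ y → D1 *ᵥ x = 0) :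
    ∃ (w : ℂ) (f : Fin 3 → ℂ), f ≠ 0 ∧ (∃ g, B *ᵥ f - w • f = D2 *ᵥ g) ∧
      (∃ g, Bᴴ *ᵥ f - star w • f = D1 *ᵥ g) := by
  set M := (D2 - D1)⁻¹ with hM
  have hinv : (D2 - D1) * M = 1 := Matrix.mul_nonsing_inv _ hdet
  have hsplit : ∀ x, D2 *ᵥ (M *ᵥ x) - D1 *ᵥ (M *ᵥ x) = x := by
    intro x
    rw [← Matrix.sub_mulVec, Matrix.mulVec_mulVec, hinv, Matrix.one_mulVec]
  set P : Matrix (Fin 3) (Fin 3) ℂ := - (D1 * M) with hPdef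
  have hPx : ∀ x, P *ᵥ x = - (D1 *ᵥ (M *ᵥ x)) := by
    intro x; rw [hPdef, Matrix.neg_mulVec, Matrix.mulVec_mulVec]
  have hP1 : ∀ y, P *ᵥ (D1 *ᵥ y) = D1 *ᵥ y := by
    intro y
    have h1 := hsplit (D1 *ᵥ y)
    have h2 : D1 *ᵥ (y + M *ᵥ (D1 *ᵥ y)) = D2 *ᵥ (M *ᵥ (D1 *ᵥ y)) := by
      rw [Matrix.mulVec_add]; nth_rw 1 [← h1]; abel
    have h3 := hdisj _ _ h2
    rw [h3] at h2
    rw [← h2] at h1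
    rw [hPx]
    simpa using h1
  have hPP : P * P = P := by
    apply Matrix.ext_of_mulVec_single
    intro i
    rw [← Matrix.mulVec_mulVec]
    conv_lhs => rw [hPx (Pi.single i 1), Matrix.mulVec_neg, hP1]
    rw [hPx]
  obtain ⟨w, hw⟩ := exists_singular (P * B + (1 - P) * Bᴴ) P hPP
  obtain ⟨f, hf0, hf⟩ := Matrix.exists_mulVec_eq_zero_iff.2 hw
  have key : P *ᵥ (B *ᵥ f - w • f) + ((Bᴴ *ᵥ f - star w • f) - P *ᵥ (Bᴴ *ᵥ f - star w • f)) = 0 := by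
    rw [← hf]
    simp only [Matrix.sub_mulVec, Matrix.add_mulVec, Matrix.mulVec_sub, Matrix.smul_mulVec,
      Matrix.mulVec_smul, ← Matrix.mulVec_mulVec, Matrix.one_mulVec, smul_sub]
    abel
  set u := B *ᵥ f - w • f with hu
  set v := Bᴴ *ᵥ f - star w • f with hv
  have hPu : P *ᵥ u = 0 := by
    have := congrArg (fun x => P *ᵥ x) key
    simpa [Matrix.mulVec_add, Matrix.mulVec_sub, Matrix.mulVec_mulVec, hPP] using this
  have hPv : v = P *ᵥ v := by
    rw [hPu, zero_add] at key
    exact sub_eq_zero.1 key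
  refine ⟨w, f, hf0, ⟨M *ᵥ u, ?_⟩, ⟨-(M *ᵥ v), ?_⟩⟩
  · have h1 := hsplit u
    rw [hPx] at hPu
    rw [neg_eq_zero] at hPu
    rw [hPu, sub_zero] at h1
    exact h1.symm
  · rw [Matrix.mulVec_neg, ← hPx]; exact hPv

theorem scal_aux (δ : ℝ) (g α β α' β' : ℂ) (hδ : 0 < δ) (hg : Complex.normSq g < δ ^ 2)
    (h1 : star β' * α = star β * α')
    (h2 : δ * (β' * star β' + β * star β) - g * β' * star β - star g * β * star β'
      = δ * (α * star α + α' * star α') - g * α * star α' - star g * α' * star α) :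
    Complex.normSq α = Complex.normSq β := by
  have h1' : β' * star α = β * star α' := by
    have := congrArg star h1
    simpa [mul_comm] using this
  set U : ℂ := δ * (β' * star β' + β * star β) - g * β' * star β - star g * β * star β' with hU
  have hpos : ∀ (x y U : ℂ),
      U = δ * (x * star x + y * star y) - g * x * star y - star g * y * star x → U = 0 →
      y = 0 := by
    intro x y U hU hU0
    have e : (δ : ℂ) * U = (δ * x - star g * y) * star (δ * x - star g * y)
        + ((δ : ℂ) ^ 2 - g * star g) * (y * star y) := by
      rw [hU]; simp; ring
    have e' : (0 : ℝ) = Complex.normSq (δ * x - star g * y) + (δ ^ 2 - Complex.normSq g) * Complex.normSq y := by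
      rw [hU0] at e
      have e3 : ∀ z : ℂ, z * star z = (Complex.normSq z : ℂ) := fun z => Complex.mul_conj z
      rw [e3, e3, e3] at e
      simp only [mul_zero] at e
      exact_mod_cast e
    have h3 := Complex.normSq_nonneg (δ * x - star g * y)
    have h4 := Complex.normSq_nonneg y
    have h5 : Complex.normSq y = 0 := by
      by_contra h
      have : 0 < Complex.normSq y := lt_of_le_of_ne h4 (Ne.symm h)
      nlinarith
    exact Complex.normSq_eq_zero.1 h5
  by_cases hU0 : U = 0
  · have hb := hpos β' β U hU hU0
    have ha := hpos (star α') (star α) U (by rw [h2]; simp only [star_star]; ring) hU0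
    rw [star_eq_zero.1 ha, hb]
  · have : (β * star β - α * star α) * U = 0 := by
      have e1 : β * star β * U = α * star α * U := by
        nth_rw 1 [h2]
        rw [hU]
        linear_combination (-(δ:ℂ) * (β * star α' ) + star g * star α * β) * h1 +
          (-(δ:ℂ) * star β' * α + g * α * star β) * h1'
      rw [sub_mul, e1, sub_self]
    have h3 := (mul_eq_zero.1 this).resolve_right hU0
    have e3 : ∀ z : ℂ, z * star z = (Complex.normSq z : ℂ) := fun z => Complex.mul_conj z
    rw [e3, e3, sub_eq_zero] at h3
    exact_mod_cast h3.symm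

theorem star_dot (x y : Fin 3 → ℂ) : star (star x ⬝ᵥ y) = star y ⬝ᵥ x := by
  rw [Matrix.star_dotProduct, star_star]

theorem dot_adj (B : Matrix (Fin 3) (Fin 3) ℂ) (x y : Fin 3 → ℂ) :
    star x ⬝ᵥ (B *ᵥ y) = star (Bᴴ *ᵥ x) ⬝ᵥ y := by
  rw [Matrix.star_mulVec, Matrix.conjTranspose_conjTranspose, Matrix.dotProduct_mulVec]

/-- Resolution of the identity for `k ⟂ d1, d2`. -/
theorem resolution (k d1 d2 : Fin 3 → ℂ) (κ δ g : ℂ) (hκ : star k ⬝ᵥ k = κ)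
    (h11 : star d1 ⬝ᵥ d1 = δ) (h22 : star d2 ⬝ᵥ d2 = δ) (h12 : star d1 ⬝ᵥ d2 = g)
    (hk1 : star k ⬝ᵥ d1 = 0) (hk2 : star k ⬝ᵥ d2 = 0) (hκ0 : κ ≠ 0)
    (hdet : δ ^ 2 - g * star g ≠ 0) (x y : Fin 3 → ℂ) :
    (δ ^ 2 - g * star g) * (κ * (star x ⬝ᵥ y) - (star x ⬝ᵥ k) * (star k ⬝ᵥ y)) =
      κ * (δ * (star x ⬝ᵥ d1) * (star d1 ⬝ᵥ y) - g * (star x ⬝ᵥ d1) * (star d2 ⬝ᵥ y)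
        - star g * (star x ⬝ᵥ d2) * (star d1 ⬝ᵥ y) + δ * (star x ⬝ᵥ d2) * (star d2 ⬝ᵥ y)) := by
  have h21 : star d2 ⬝ᵥ d1 = star g := by rw [← h12, star_dot]
  have h1k : star d1 ⬝ᵥ k = 0 := by rw [← star_dot, hk1, star_zero]
  have h2k : star d2 ⬝ᵥ k = 0 := by rw [← star_dot, hk2, star_zero]
  let W : Matrix (Fin 3) (Fin 3) ℂ := Matrix.of ![star k, star d1, star d2]
  have hW : ∀ v, W *ᵥ v = ![star k ⬝ᵥ v, star d1 ⬝ᵥ v, star d2 ⬝ᵥ v] := by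
    intro v; ext i; fin_cases i <;> rfl
  have hWW : W * Matrix.of (fun i j => (![k, d1, d2] : Fin 3 → Fin 3 → ℂ) j i) =
      !![κ, 0, 0; 0, δ, g; 0, star g, δ] := by
    ext i j
    fin_cases i <;> fin_cases j <;>
      first
      | exact hκ | exact hk1 | exact hk2 | exact h1k | exact h2k | exact h11 | exact h22
      | exact h12 | exact h21
  have hWdet : W.det ≠ 0 := by
    intro h
    have := congrArg Matrix.det hWW
    rw [Matrix.det_mul, h, zero_mul, Matrix.det_fin_three] at this
    apply mul_ne_zero hκ0 hdet
    simp only [Matrix.of_apply, Matrix.cons_val] at this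
    linear_combination -this
  have hinj : ∀ v, star k ⬝ᵥ v = 0 → star d1 ⬝ᵥ v = 0 → star d2 ⬝ᵥ v = 0 → v = 0 := by
    intro v a b c
    by_contra hv
    exact hWdet (Matrix.exists_mulVec_eq_zero_iff.1 ⟨v, hv, by
      rw [hW, a, b, c]; ext i; fin_cases i <;> rfl⟩)
  have hr := hinj ((κ * (δ ^ 2 - g * star g)) • y - ((δ ^ 2 - g * star g) * (star k ⬝ᵥ y)) • k
    - (κ * (δ * (star d1 ⬝ᵥ y) - g * (star d2 ⬝ᵥ y))) • d1
    - (κ * (δ * (star d2 ⬝ᵥ y) - star g * (star d1 ⬝ᵥ y))) • d2)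
    (by simp only [dotProduct_sub, dotProduct_smul, hκ, hk1, hk2, smul_eq_mul]; ring)
    (by simp only [dotProduct_sub, dotProduct_smul, h1k, h11, h12, smul_eq_mul]; ring)
    (by simp only [dotProduct_sub, dotProduct_smul, h2k, h21, h22, smul_eq_mul]; ring)
  have := congrArg (fun v => star x ⬝ᵥ v) hr
  simp only [dotProduct_sub, dotProduct_smul, smul_eq_mul, dotProduct_zero] at this
  linear_combination this

theorem exists_dil (B : Matrix (Fin 3) (Fin 3) ℂ) (k d1 d2 : Fin 3 → ℂ) (δ : ℝ)
    (h : vecMulVec d2 (star d2) - vecMulVec d1 (star d1) = Bᴴ * B - B * Bᴴ)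
    (hk : k ≠ 0) (hk1 : star k ⬝ᵥ d1 = 0) (hk2 : star k ⬝ᵥ d2 = 0)
    (hδ : 0 < δ) (h11 : star d1 ⬝ᵥ d1 = δ) (h22 : star d2 ⬝ᵥ d2 = δ)
    (hg : Complex.normSq (star d1 ⬝ᵥ d2) < δ ^ 2) :
    ∃ e t : ℂ, e * star e = 1 ∧
      e • (Bᴴ *ᵥ d2) - B *ᵥ d1 = (e * star t) • d2 - t • d1 := by
  set g := star d1 ⬝ᵥ d2 with hgdef
  set κ := star k ⬝ᵥ k with hκ
  have hκ0 : κ ≠ 0 := by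
    intro h0; exact hk (dotProduct_star_self_eq_zero.1 h0)
  have e3 : ∀ z : ℂ, z * star z = (Complex.normSq z : ℂ) := fun z => Complex.mul_conj z
  have hdet : (δ : ℂ) ^ 2 - g * star g ≠ 0 := by
    rw [e3]; intro h0
    have : δ ^ 2 - Complex.normSq g = 0 := by exact_mod_cast h0
    linarith
  have R := resolution k d1 d2 κ δ g hκ.symm h11 h22 hgdef.symm hk1 hk2 hκ0 hdet
  have h21 : star d2 ⬝ᵥ d1 = star g := by rw [hgdef, star_dot]
  have htr : ∀ (M : Matrix (Fin 3) (Fin 3) ℂ) (d : Fin 3 → ℂ),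
      (M * vecMulVec d (star d)).trace = star d ⬝ᵥ (M *ᵥ d) := by
    intro M d
    rw [Matrix.mul_vecMulVec, Matrix.trace_vecMulVec, dotProduct_comm]
  have F1 : star d1 ⬝ᵥ (B *ᵥ d1) = star d2 ⬝ᵥ (B *ᵥ d2) := by
    rw [← htr, ← htr, eq_comm, ← sub_eq_zero, ← Matrix.trace_sub, ← mul_sub, h, mul_sub,
      Matrix.trace_sub, sub_eq_zero, Matrix.trace_mul_comm B (Bᴴ * B), Matrix.mul_assoc, ]
    rw [Matrix.trace_mul_comm Bᴴ (B * B), Matrix.mul_assoc]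
  have F2 : star d1 ⬝ᵥ (B *ᵥ (B *ᵥ d1)) = star d2 ⬝ᵥ (B *ᵥ (B *ᵥ d2)) := by
    rw [Matrix.mulVec_mulVec, Matrix.mulVec_mulVec]
    rw [← htr, ← htr, eq_comm, ← sub_eq_zero, ← Matrix.trace_sub, ← mul_sub, h, mul_sub,
      Matrix.trace_sub, sub_eq_zero, Matrix.trace_mul_comm (B * B) (Bᴴ * B), Matrix.mul_assoc]
    rw [Matrix.trace_mul_comm Bᴴ (B * (B * B)), Matrix.mul_assoc, Matrix.mul_assoc,
      Matrix.mul_assoc]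
  have F3 : star (B *ᵥ k) ⬝ᵥ (B *ᵥ k) = star (Bᴴ *ᵥ k) ⬝ᵥ (Bᴴ *ᵥ k) := by
    have h0 := congrArg (fun M => star k ⬝ᵥ (M *ᵥ k)) h
    simp only [Matrix.sub_mulVec, dotProduct_sub, Matrix.vecMulVec_mulVec,
      ← Matrix.mulVec_mulVec] at h0
    rw [dot_adj B k (Bᴴ *ᵥ k), dot_adj Bᴴ k (B *ᵥ k), conjTranspose_conjTranspose] at h0
    simp only [dotProduct_smul, hk1, hk2] at h0
    simp only [smul_zero, sub_zero] at h0
    exact sub_eq_zero.1 h0.symm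
  -- scalars
  set m := star d1 ⬝ᵥ (B *ᵥ d1) with hm
  set l := star d2 ⬝ᵥ (B *ᵥ d1) with hl
  set l' := star d1 ⬝ᵥ (B *ᵥ d2) with hl'
  set α := star k ⬝ᵥ (B *ᵥ d1) with hα
  set α' := star k ⬝ᵥ (B *ᵥ d2) with hα'
  set β := star k ⬝ᵥ (Bᴴ *ᵥ d2) with hβ
  set β' := star k ⬝ᵥ (Bᴴ *ᵥ d1) with hβ'
  set c := star k ⬝ᵥ (B *ᵥ k) with hc
  have a1 : star d1 ⬝ᵥ (B *ᵥ k) = star β' := by rw [hβ', star_dot, dot_adj]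
  have a2 : star d2 ⬝ᵥ (B *ᵥ k) = star β := by rw [hβ, star_dot, dot_adj]
  have a3 : star d1 ⬝ᵥ (Bᴴ *ᵥ k) = star α := by
    rw [hα, star_dot, dot_adj, conjTranspose_conjTranspose]
  have a4 : star d2 ⬝ᵥ (Bᴴ *ᵥ k) = star α' := by
    rw [hα', star_dot, dot_adj, conjTranspose_conjTranspose]
  have a5 : star k ⬝ᵥ (Bᴴ *ᵥ k) = star c := by
    rw [hc, star_dot, dot_adj, conjTranspose_conjTranspose]
  have b1 : star d1 ⬝ᵥ (Bᴴ *ᵥ d2) = star l := by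
    rw [hl, star_dot, dot_adj, conjTranspose_conjTranspose]
  have b2 : star d2 ⬝ᵥ (Bᴴ *ᵥ d2) = star m := by
    rw [F1, star_dot, dot_adj, conjTranspose_conjTranspose]
  have hab : Complex.normSq α = Complex.normSq β := by
    have R1 := R (Bᴴ *ᵥ d1) (B *ᵥ d1)
    have R2 := R (Bᴴ *ᵥ d2) (B *ᵥ d2)
    simp only [← dot_adj, a1, a2] at R1 R2
    rw [F2] at R1
    have R3 := R (B *ᵥ k) (B *ᵥ k)
    have R4 := R (Bᴴ *ᵥ k) (Bᴴ *ᵥ k)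
    have s1 : star (B *ᵥ k) ⬝ᵥ d1 = β' := by rw [← star_dot, a1, star_star]
    have s2 : star (B *ᵥ k) ⬝ᵥ d2 = β := by rw [← star_dot, a2, star_star]
    have s3 : star (Bᴴ *ᵥ k) ⬝ᵥ d1 = α := by rw [← star_dot, a3, star_star]
    have s4 : star (Bᴴ *ᵥ k) ⬝ᵥ d2 = α' := by rw [← star_dot, a4, star_star]
    have s5 : star (B *ᵥ k) ⬝ᵥ k = star c := by rw [← star_dot]
    have s6 : star (Bᴴ *ᵥ k) ⬝ᵥ k = c := by rw [← star_dot, a5, star_star]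
    rw [s1, s2, s5, a1, a2, F3, ← hc] at R3
    rw [s3, s4, s6, a3, a4, a5] at R4
    refine scal_aux δ g α β α' β' hδ hg ?_ ?_
    · apply mul_left_cancel₀ hdet
      rw [← hm, ← hl, ← hl', ← hα] at R1
      rw [← hl, ← hl', ← F1, ← hα'] at R2
      linear_combination R2 - R1
    · apply mul_left_cancel₀ hκ0
      linear_combination R4 - R3
  obtain ⟨e, he, heβ⟩ : ∃ e : ℂ, e * star e = 1 ∧ e * β = α := by
    by_cases hb : β = 0
    · refine ⟨1, by simp, ?_⟩
      rw [hb] at hab ⊢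
      simp at hab
      simp [hab]
    · refine ⟨α / β, ?_, div_mul_cancel₀ _ hb⟩
      rw [e3, Complex.normSq_div, hab, div_self (by simpa using hb)]
      simp
  let Y := m - e * star l
  let t := (δ * Y + e * g * star Y) / ((δ : ℂ) ^ 2 - g * star g)
  have hreal : star ((δ : ℂ) ^ 2 - g * star g) = (δ : ℂ) ^ 2 - g * star g := by
    simp [mul_comm]
  have ht : δ * t - e * g * star t = Y := by
    have : star t = (δ * star Y + star e * star g * Y) / ((δ : ℂ) ^ 2 - g * star g) := by
      simp only [t]
      rw [star_div₀, hreal]; simp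
    rw [this]
    simp only [t]
    rw [mul_div_assoc', mul_div_assoc', ← sub_div, div_eq_iff hdet]
    linear_combination (- g * star g * Y) * he
  have ht' : δ * star t - star e * star g * t = star m - star e * l := by
    have := congrArg star ht
    simp only [Y] at this
    simpa using this
  refine ⟨e, t, he, ?_⟩
  set z := e • (Bᴴ *ᵥ d2) - B *ᵥ d1 - ((e * star t) • d2 - t • d1) with hz
  have z0 : star k ⬝ᵥ z = 0 := by
    simp only [hz, dotProduct_sub, dotProduct_smul, smul_eq_mul, hk1, hk2, ← hβ, ← hα]
    linear_combination heβ
  have z1 : star d1 ⬝ᵥ z = 0 := by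
    simp only [hz, dotProduct_sub, dotProduct_smul, smul_eq_mul, h11, ← hgdef, b1, ← hm]
    simp only [Y] at ht
    linear_combination ht
  have z2 : star d2 ⬝ᵥ z = 0 := by
    simp only [hz, dotProduct_sub, dotProduct_smul, smul_eq_mul, h22, h21, b2, ← hl]
    linear_combination (-e) * ht' + (star g * t - l) * (-he)
  have Rz := R z z
  rw [z0, z1, z2] at Rz
  have : star z ⬝ᵥ z = 0 := by
    have : ((δ : ℂ) ^ 2 - g * star g) * (κ * (star z ⬝ᵥ z)) = 0 := by linear_combination Rz
    exact (mul_eq_zero.1 ((mul_eq_zero.1 this).resolve_left hdet)).resolve_left hκ0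
  have hz0 : z = 0 := dotProduct_star_self_eq_zero.1 this
  exact sub_eq_zero.1 hz0

theorem eig_normal {n : Type} [Fintype n] [DecidableEq n] (N : Matrix n n ℂ) (hN : N * Nᴴ = Nᴴ * N)
    (Z : Set n) (i₀ : n) (hi₀ : i₀ ∉ Z) (hZ : ∀ i ∈ Z, ∀ j, N i j = 0) :
    ∃ (w : ℂ) (F : n → ℂ), F ≠ 0 ∧ (∀ i ∈ Z, F i = 0) ∧ N *ᵥ F = w • F ∧
      Nᴴ *ᵥ F = star w • F := by
  let p : Submodule ℂ (n → ℂ) :=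
    { carrier := {F | ∀ i ∈ Z, F i = 0}
      add_mem' := by
        intro a b ha hb i hi
        simp [ha i hi, hb i hi]
      zero_mem' := by intro i _; rfl
      smul_mem' := by
        intro c a ha i hi
        simp [ha i hi] }
  have hp : ∀ F ∈ p, Matrix.toLin' N F ∈ p := by
    intro F _ i hi
    simp only [Matrix.toLin'_apply, Matrix.mulVec, dotProduct]
    exact Finset.sum_eq_zero fun j _ => by rw [hZ i hi j, zero_mul]
  have hmem : (Pi.single i₀ 1 : n → ℂ) ∈ p := by
    intro i hi
    have : i ≠ i₀ := fun h => hi₀ (h ▸ hi)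
    simp [this]
  haveI : Nontrivial p := by
    refine ⟨⟨⟨Pi.single i₀ 1, hmem⟩, 0, ?_⟩⟩
    intro h
    have := congrFun (congrArg Subtype.val h) i₀
    simp at this
  obtain ⟨w, hw⟩ := Module.End.exists_eigenvalue ((Matrix.toLin' N).restrict hp)
  obtain ⟨F, hF⟩ := hw.exists_hasEigenvector
  have h1 : N *ᵥ (F : n → ℂ) = w • (F : n → ℂ) := by
    have := congrArg Subtype.val hF.apply_eq_smul
    simpa using this
  refine ⟨w, F, fun h => hF.2 (Subtype.ext h), fun i hi => F.2 i hi, h1, ?_⟩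
  set G : n → ℂ := F.1
  set M := N - w • (1 : Matrix n n ℂ) with hM
  have hMN : M * Mᴴ = Mᴴ * M := by
    simp only [hM, conjTranspose_sub, conjTranspose_smul, conjTranspose_one, mul_sub, sub_mul, hN,
      smul_mul_assoc, mul_smul_comm, one_mul, mul_one, smul_sub]
    rw [smul_comm]
    abel
  have hMG : M *ᵥ G = 0 := by
    rw [hM, Matrix.sub_mulVec, h1, Matrix.smul_mulVec, Matrix.one_mulVec, sub_self]
  have h2 : star (Mᴴ *ᵥ G) ⬝ᵥ (Mᴴ *ᵥ G) = 0 := by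
    rw [Matrix.star_mulVec, conjTranspose_conjTranspose, ← Matrix.dotProduct_mulVec,
      Matrix.mulVec_mulVec, hMN, ← Matrix.mulVec_mulVec, hMG]
    simp
  have h3 : Mᴴ *ᵥ G = 0 := dotProduct_star_self_eq_zero.1 h2
  rw [hM, conjTranspose_sub, Matrix.sub_mulVec, conjTranspose_smul, conjTranspose_one,
    Matrix.smul_mulVec, Matrix.one_mulVec, sub_eq_zero] at h3
  exact h3

theorem psd_kernel {n : Type} [Fintype n] {D : Matrix n n ℂ} (hD : D.PosSemidef) {x : n → ℂ}
    (h : star x ⬝ᵥ (D *ᵥ x) = 0) : D *ᵥ x = 0 := by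
  classical
  exact (hD.dotProduct_mulVec_zero_iff x).1 h

theorem psd_symm {n : Type} [Fintype n] {D : Matrix n n ℂ} (hD : D.PosSemidef) (x y : n → ℂ) :
    star x ⬝ᵥ (D *ᵥ y) = star (D *ᵥ x) ⬝ᵥ y := by
  rw [Matrix.star_mulVec, hD.isHermitian.eq, Matrix.dotProduct_mulVec]

theorem rank_one {D : Matrix (Fin 3) (Fin 3) ℂ} (hD : D.PosSemidef) (x : Fin 3 → ℂ)
    (hx : D *ᵥ x ≠ 0) (hr : ∀ y, ∃ b : ℂ, D *ᵥ y = b • (D *ᵥ x)) :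
    ∃ d, D = vecMulVec d (star d) := by
  have hs0 := hD.dotProduct_mulVec_nonneg x
  have hs1 : star x ⬝ᵥ (D *ᵥ x) ≠ 0 := fun h => hx (psd_kernel hD h)
  obtain ⟨s, hs⟩ : ∃ s : ℝ, star x ⬝ᵥ (D *ᵥ x) = s :=
    ⟨(star x ⬝ᵥ (D *ᵥ x)).re, (Complex.eq_re_of_ofReal_le hs0)⟩
  rw [hs] at hs0 hs1
  have hspos : 0 < s := by
    have h0 : (0 : ℝ) ≤ s := by exact_mod_cast hs0
    exact lt_of_le_of_ne h0 (fun h => hs1 (by rw [← h]; simp))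
  refine ⟨((Real.sqrt s)⁻¹ : ℂ) • (D *ᵥ x), ?_⟩
  apply Matrix.ext_of_mulVec_single
  intro i
  set y : Fin 3 → ℂ := Pi.single i 1
  obtain ⟨b, hb⟩ := hr y
  have h1 : star (D *ᵥ x) ⬝ᵥ y = b * s := by
    rw [← psd_symm hD, hb, dotProduct_smul, hs, smul_eq_mul]
  rw [Matrix.vecMulVec_mulVec, hb, star_smul, smul_dotProduct, h1]
  have hss : ((Real.sqrt s : ℝ) : ℂ) * (Real.sqrt s : ℝ) = s := by
    rw [← Complex.ofReal_mul, Real.mul_self_sqrt hspos.le]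
  have hs2 : ((Real.sqrt s : ℝ) : ℂ) ≠ 0 := by
    have := (Real.sqrt_pos.2 hspos).ne'
    exact_mod_cast this
  ext j
  simp
  rw [← hss]
  field_simp

theorem pv_sing (B D1 D2 : Matrix (Fin 3) (Fin 3) ℂ) (hD1 : D1.PosSemidef) (hD2 : D2.PosSemidef)
    (h : D2 - D1 = Bᴴ * B - B * Bᴴ)
    (hdisj : ∀ x y, D1 *ᵥ x = D2 *ᵥ y → D1 *ᵥ x = 0)
    (k : Fin 3 → ℂ) (hk : k ≠ 0) (hkk : D1 *ᵥ k = D2 *ᵥ k)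
    (Z : Set (Fin 3)) (i₀ : Fin 3) (hi₀ : i₀ ∉ Z) (hZB : ∀ i ∈ Z, ∀ j, B i j = 0)
    (hZD : ∀ i ∈ Z, D2 i i = 0) :
    ∃ (w : ℂ) (f : Fin 3 → ℂ), f ≠ 0 ∧ (∀ i ∈ Z, f i = 0) ∧
      (∃ g, B *ᵥ f - w • f = D2 *ᵥ g) ∧ (∃ g, Bᴴ *ᵥ f - star w • f = D1 *ᵥ g) := by
  have hk1 : D1 *ᵥ k = 0 := hdisj _ _ hkk
  have hk2 : D2 *ᵥ k = 0 := by rw [← hkk, hk1]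
  have htr : D1.trace = D2.trace := by
    have := congrArg Matrix.trace h
    rw [Matrix.trace_sub, Matrix.trace_sub, Matrix.trace_mul_comm, sub_self, sub_eq_zero] at this
    exact this.symm
  by_cases h0 : D1 = 0
  · have h02 : D2 = 0 := by
      rw [h0, Matrix.trace_zero] at htr
      exact hD2.trace_eq_zero_iff.1 htr.symm
    have hN : B * Bᴴ = Bᴴ * B := by
      rw [h0, h02, sub_zero] at h
      exact (sub_eq_zero.1 h.symm).symm
    obtain ⟨w, f, hf, hfZ, h1, h2⟩ := eig_normal B hN Z i₀ hi₀ hZB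
    exact ⟨w, f, hf, hfZ, ⟨0, by rw [h1]; simp⟩, ⟨0, by rw [h2]; simp⟩⟩
  have h02 : D2 ≠ 0 := by
    intro h2
    rw [h2, Matrix.trace_zero] at htr
    exact h0 (hD1.trace_eq_zero_iff.1 htr)
  have hex : ∀ D : Matrix (Fin 3) (Fin 3) ℂ, D ≠ 0 → ∃ x, D *ᵥ x ≠ 0 := by
    intro D hD
    by_contra! hc
    exact hD (Matrix.ext_of_mulVec_single fun i => by rw [hc, Matrix.zero_mulVec])
  obtain ⟨x1, hx1⟩ := hex D1 h0
  obtain ⟨x2, hx2⟩ := hex D2 h02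
  set v1 := D1 *ᵥ x1 with hv1
  set v2 := D2 *ᵥ x2 with hv2
  have hkD1 : ∀ x, star k ⬝ᵥ (D1 *ᵥ x) = 0 := by
    intro x; rw [psd_symm hD1, hk1]; simp
  have hkD2 : ∀ x, star k ⬝ᵥ (D2 *ᵥ x) = 0 := by
    intro x; rw [psd_symm hD2, hk2]; simp
  have hkk0 : star k ⬝ᵥ k ≠ 0 := fun h => hk (dotProduct_star_self_eq_zero.1 h)
  have hindep : ∀ a b c : ℂ, a • k + b • v1 + c • v2 = 0 → a = 0 ∧ b = 0 ∧ c = 0 := by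
    intro a b c habc
    have ha : a = 0 := by
      have := congrArg (fun z => star k ⬝ᵥ z) habc
      simp only [dotProduct_add, dotProduct_smul, hv1, hv2, hkD1, hkD2, dotProduct_zero,
        mul_zero, add_zero, smul_eq_mul] at this
      exact (mul_eq_zero.1 this).resolve_right hkk0
    rw [ha, zero_smul, zero_add] at habc
    have h3 : D1 *ᵥ (b • x1) = D2 *ᵥ (-c • x2) := by
      rw [Matrix.mulVec_smul, Matrix.mulVec_smul, neg_smul]
      exact eq_neg_of_add_eq_zero_left habc
    have h4 := hdisj _ _ h3
    rw [Matrix.mulVec_smul] at h4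
    have hb := (smul_eq_zero.1 h4).resolve_right hx1
    rw [hb, zero_smul, zero_add] at habc
    exact ⟨ha, hb, (smul_eq_zero.1 habc).resolve_right hx2⟩
  have hspan : ∀ z : Fin 3 → ℂ, ∃ a b c : ℂ, z = a • k + b • v1 + c • v2 := by
    intro z
    let W : Matrix (Fin 3) (Fin 3) ℂ := Matrix.of (fun i j => (![k, v1, v2] : Fin 3 → Fin 3 → ℂ) j i)
    have hW : ∀ v, W *ᵥ v = v 0 • k + v 1 • v1 + v 2 • v2 := by
      intro v; ext i
      simp only [W, Matrix.mulVec, dotProduct, Fin.sum_univ_three, Matrix.of_apply]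
      simp [mul_comm]
    have hWd : W.det ≠ 0 := by
      intro hd
      obtain ⟨v, hv, hv0⟩ := Matrix.exists_mulVec_eq_zero_iff.2 hd
      rw [hW] at hv0
      obtain ⟨a, b, c⟩ := hindep _ _ _ hv0
      exact hv (by ext i; fin_cases i <;> simp [a, b, c])
    refine ⟨(W⁻¹ *ᵥ z) 0, (W⁻¹ *ᵥ z) 1, (W⁻¹ *ᵥ z) 2, ?_⟩
    rw [← hW, Matrix.mulVec_mulVec, Matrix.mul_nonsing_inv _ (isUnit_iff_ne_zero.2 hWd),
      Matrix.one_mulVec]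
  obtain ⟨d1, hd1⟩ := rank_one hD1 x1 hx1 (by
    intro y
    obtain ⟨a, b, c, habc⟩ := hspan (D1 *ᵥ y)
    have ha : a = 0 := by
      have := congrArg (fun z => star k ⬝ᵥ z) habc
      simp only [dotProduct_add, dotProduct_smul, hv1, hv2, hkD1, hkD2,
        mul_zero, add_zero, smul_eq_mul] at this
      exact (mul_eq_zero.1 this.symm).resolve_right hkk0
    refine ⟨b, ?_⟩
    have h3 : D1 *ᵥ (y - b • x1) = D2 *ᵥ (c • x2) := by
      rw [Matrix.mulVec_sub, Matrix.mulVec_smul, Matrix.mulVec_smul, habc, ha]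
      simp [← hv1, ← hv2]
    have h4 := hdisj _ _ h3
    rw [Matrix.mulVec_sub, Matrix.mulVec_smul] at h4
    exact sub_eq_zero.1 h4)
  obtain ⟨d2, hd2⟩ := rank_one hD2 x2 hx2 (by
    intro y
    obtain ⟨a, b, c, habc⟩ := hspan (D2 *ᵥ y)
    have ha : a = 0 := by
      have := congrArg (fun z => star k ⬝ᵥ z) habc
      simp only [dotProduct_add, dotProduct_smul, hv1, hv2, hkD1, hkD2,
        mul_zero, add_zero, smul_eq_mul] at this
      exact (mul_eq_zero.1 this.symm).resolve_right hkk0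
    refine ⟨c, ?_⟩
    have h3 : D1 *ᵥ (b • x1) = D2 *ᵥ (y - c • x2) := by
      rw [Matrix.mulVec_sub, Matrix.mulVec_smul, Matrix.mulVec_smul, habc, ha]
      simp [← hv1, ← hv2]
    have h4 := hdisj _ _ h3
    rw [h4] at h3
    rw [Matrix.mulVec_sub, Matrix.mulVec_smul] at h3
    exact sub_eq_zero.1 h3.symm)
  have hD1v : ∀ x, D1 *ᵥ x = (star d1 ⬝ᵥ x) • d1 := by
    intro x; rw [hd1, Matrix.vecMulVec_mulVec]; simp
  have hD2v : ∀ x, D2 *ᵥ x = (star d2 ⬝ᵥ x) • d2 := by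
    intro x; rw [hd2, Matrix.vecMulVec_mulVec]; simp
  have hd10 : d1 ≠ 0 := by rintro rfl; apply h0; rw [hd1]; ext i j; simp [vecMulVec_apply]
  have hd20 : d2 ≠ 0 := by rintro rfl; apply h02; rw [hd2]; ext i j; simp [vecMulVec_apply]
  have hkd1 : star k ⬝ᵥ d1 = 0 := by
    rw [← star_dot, star_eq_zero]
    rw [hD1v] at hk1
    exact (smul_eq_zero.1 hk1).resolve_right hd10
  have hkd2 : star k ⬝ᵥ d2 = 0 := by
    rw [← star_dot, star_eq_zero]
    rw [hD2v] at hk2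
    exact (smul_eq_zero.1 hk2).resolve_right hd20
  have h12 : star d2 ⬝ᵥ d2 = star d1 ⬝ᵥ d1 := by
    have := htr
    rw [hd1, hd2, Matrix.trace_vecMulVec, Matrix.trace_vecMulVec] at this
    rw [dotProduct_comm, ← this, dotProduct_comm]
  have hδ0 : 0 < star d1 ⬝ᵥ d1 := Matrix.dotProduct_star_self_pos_iff.2 hd10
  obtain ⟨δ, hδ⟩ : ∃ δ : ℝ, star d1 ⬝ᵥ d1 = δ :=
    ⟨(star d1 ⬝ᵥ d1).re, Complex.eq_re_of_ofReal_le hδ0.le⟩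
  have hδpos : 0 < δ := by rw [hδ] at hδ0; exact_mod_cast hδ0
  rw [hδ] at h12
  have hg : Complex.normSq (star d1 ⬝ᵥ d2) < δ ^ 2 := by
    by_contra! hc
    set g := star d1 ⬝ᵥ d2 with hgd
    have h21 : star d2 ⬝ᵥ d1 = star g := by rw [hgd, star_dot]
    set z := (δ : ℂ) • d2 - g • d1 with hz
    have hzz : star z ⬝ᵥ z = ((δ * (δ ^ 2 - Complex.normSq g) : ℝ) : ℂ) := by
      have e3 : (Complex.normSq g : ℂ) = g * star g := (Complex.mul_conj g).symm
      push_cast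
      rw [e3]
      simp only [hz, star_sub, star_smul, sub_dotProduct, dotProduct_sub, smul_dotProduct,
        dotProduct_smul, smul_eq_mul, hδ, h12, h21, ← hgd]
      simp
      ring
    have hz0 : z = 0 := by
      apply dotProduct_star_self_eq_zero.1
      apply le_antisymm _ (dotProduct_star_self_nonneg z)
      rw [hzz]
      have : δ * (δ ^ 2 - Complex.normSq g) ≤ 0 :=
        mul_nonpos_of_nonneg_of_nonpos hδpos.le (by linarith)
      exact_mod_cast this
    have h3 : D1 *ᵥ ((g * (δ : ℂ)⁻¹) • d1) = D2 *ᵥ d2 := by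
      rw [hD1v, hD2v, h12, dotProduct_smul, hδ]
      have : (δ : ℂ) ≠ 0 := by exact_mod_cast hδpos.ne'
      rw [sub_eq_zero.1 hz0, smul_eq_mul, mul_assoc, inv_mul_cancel₀ this, mul_one]
    have h4 := hdisj _ _ h3
    rw [h4, hD2v, h12] at h3
    have := smul_eq_zero.1 h3.symm
    rcases this with h | h
    · exact hδpos.ne' (by exact_mod_cast h)
    · exact hd20 h
  obtain ⟨e, t, he, het⟩ := exists_dil B k d1 d2 δ (by rw [← hd1, ← hd2, h]) hk hkd1 hkd2 hδpos
    hδ h12 hg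
  let N : Matrix (Fin 3 ⊕ Unit) (Fin 3 ⊕ Unit) ℂ :=
    fromBlocks B (Matrix.of fun i _ => e * d2 i) (Matrix.of fun _ j => star (d1 j))
      (Matrix.of fun _ _ => t)
  have hent : ∀ i j, (B * Bᴴ) i j + d2 i * star (d2 j) = (Bᴴ * B) i j + d1 i * star (d1 j) := by
    intro i j
    have := congrFun (congrFun h i) j
    rw [hd1, hd2] at this
    simp only [Matrix.sub_apply, vecMulVec_apply, Pi.star_apply] at this
    linear_combination this
  have hvec : ∀ i, e * (Bᴴ *ᵥ d2) i + t * d1 i = (B *ᵥ d1) i + e * star t * d2 i := by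
    intro i
    have := congrFun het i
    simp at this
    simp
    linear_combination this
  have hNN : N * Nᴴ = Nᴴ * N := by
    simp only [N, fromBlocks_conjTranspose, fromBlocks_multiply]
    congr 1
    · ext i j
      have := hent i j
      simp only [Matrix.add_apply]
      simp only [Matrix.mul_apply (M := Matrix.of _), Matrix.mul_apply (M := (Matrix.of _)ᴴ),
        Matrix.conjTranspose_apply, Matrix.of_apply, Finset.univ_unique, Finset.sum_singleton,
        star_mul', star_star]
      linear_combination this + d2 i * star (d2 j) * he
    · ext i j
      have := hvec i
      simp only [Matrix.mulVec, dotProduct] at this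
      simp only [Matrix.add_apply, Matrix.mul_apply,
        Matrix.conjTranspose_apply, Matrix.of_apply, Finset.univ_unique, Finset.sum_singleton,
        star_mul', star_star] at this ⊢
      rw [Finset.mul_sum] at this
      have e1 : ∑ x, star (B x i) * (e * d2 x) = ∑ x, e * (star (B x i) * d2 x) :=
        Finset.sum_congr rfl fun _ _ => by ring
      rw [e1]
      linear_combination -this
    · ext i j
      have := congrArg star (hvec j)
      simp only [Matrix.mulVec, dotProduct] at this
      simp only [Matrix.add_apply, Matrix.mul_apply, star_add, star_sum,
        Matrix.conjTranspose_apply, Matrix.of_apply, Finset.univ_unique, Finset.sum_singleton,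
        star_mul', star_star] at this ⊢
      rw [Finset.mul_sum] at this
      have e1 : ∑ x, star e * star (d2 x) * B x j = ∑ x, star e * (B x j * star (d2 x)) :=
        Finset.sum_congr rfl fun _ _ => by ring
      have e2 : ∑ x, star (d1 x) * star (B j x) = ∑ x, star (B j x) * star (d1 x) :=
        Finset.sum_congr rfl fun _ _ => by ring
      rw [e1, e2]
      linear_combination -this
    · ext i j
      have a1 := hδ
      have a2 := h12
      simp only [dotProduct, Pi.star_apply] at a1 a2
      simp only [Matrix.add_apply, Matrix.mul_apply, star_add, star_sum,
        Matrix.conjTranspose_apply, Matrix.of_apply, Finset.univ_unique, Finset.sum_singleton,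
        star_mul', star_star]
      have e1 : ∑ x, star e * star (d2 x) * (e * d2 x) = ∑ x, star (d2 x) * d2 x :=
        Finset.sum_congr rfl fun x _ => by linear_combination (star (d2 x) * d2 x) * he
      rw [e1, a1, a2]
      ring
  have hd2Z : ∀ i ∈ Z, d2 i = 0 := by
    intro i hi
    have := hZD i hi
    rw [hd2, vecMulVec_apply] at this
    simpa using this
  obtain ⟨w, F, hF, hFZ, hF1, hF2⟩ := eig_normal N hNN (Sum.inl '' Z) (Sum.inr ()) (by simp) (by
    rintro _ ⟨i, hi, rfl⟩ j
    rcases j with j | j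
    · exact hZB i hi j
    · simp [N, hd2Z i hi])
  set f : Fin 3 → ℂ := fun i => F (Sum.inl i) with hfdef
  set c := F (Sum.inr ()) with hcdef
  have g1 : ∀ i, (B *ᵥ f) i + e * d2 i * c = w * f i := by
    intro i
    have := congrFun hF1 (Sum.inl i)
    simpa [N, Matrix.mulVec, dotProduct, Fintype.sum_sum_type] using this
  have g2 : ∀ i, (Bᴴ *ᵥ f) i + d1 i * c = star w * f i := by
    intro i
    have := congrFun hF2 (Sum.inl i)
    simpa [N, Matrix.mulVec, dotProduct, Fintype.sum_sum_type] using this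
  have hδC : (δ : ℂ) ≠ 0 := by exact_mod_cast hδpos.ne'
  refine ⟨w, f, ?_, fun i hi => hFZ _ ⟨i, hi, rfl⟩, ⟨(-(e * c) * (δ : ℂ)⁻¹) • d2, ?_⟩,
    ⟨(-c * (δ : ℂ)⁻¹) • d1, ?_⟩⟩
  · intro hf0
    have hc : c = 0 := by
      by_contra hc
      apply hd10
      ext i
      have := g2 i
      rw [hf0] at this
      simpa [hc] using this
    apply hF
    ext i
    rcases i with i | i
    · exact congrFun hf0 i
    · exact hc
  · rw [hD2v, dotProduct_smul, h12, smul_eq_mul, mul_assoc, inv_mul_cancel₀ hδC, mul_one]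
    ext i
    have := g1 i
    simp
    linear_combination this
  · rw [hD1v, dotProduct_smul, hδ, smul_eq_mul, mul_assoc, inv_mul_cancel₀ hδC, mul_one]
    ext i
    have := g2 i
    simp
    simp at this
    linear_combination this

def PV (A B C : Matrix (Fin 3) (Fin 3) ℂ) : Prop :=
  ∃ (a b : ℂ) (f : Fin 3 → ℂ), f ≠ 0 ∧ (a ≠ 0 ∨ b ≠ 0) ∧
    (∃ x y, A *ᵥ x + B *ᵥ y = a • f ∧ Bᴴ *ᵥ x + C *ᵥ y = b • f) ∧
    (∃ x y, A *ᵥ x + Bᴴ *ᵥ y = star a • f ∧ B *ᵥ x + C *ᵥ y = star b • f)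

theorem schur_psd (q : Fin 3 → ℂ) (B C : Matrix (Fin 3) (Fin 3) ℂ)
    (h : (fromBlocks (diagonal q) B Bᴴ C).PosSemidef) (hB : diagonal q * B = B) :
    (C - Bᴴ * B).PosSemidef := by
  have := h.conjTranspose_mul_mul_same (Matrix.fromRows (-B) 1)
  rw [Matrix.mul_assoc, Matrix.fromBlocks_mul_fromRows, Matrix.conjTranspose_fromRows_eq_fromCols_conjTranspose,
    Matrix.fromCols_mul_fromRows] at this
  convert this using 1
  simp [hB]
  abel

theorem zero_row (q : Fin 3 → ℂ) (B C : Matrix (Fin 3) (Fin 3) ℂ)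
    (h : (fromBlocks (diagonal q) B Bᴴ C).PosSemidef) (i : Fin 3) (hi : q i = 0) (j : Fin 3) :
    B i j = 0 := by
  have h1 : fromBlocks (diagonal q) B Bᴴ C *ᵥ (Pi.single (Sum.inl i) 1) = 0 := by
    apply psd_kernel h
    simp [hi]
  have := congrFun h1 (Sum.inr j)
  simpa using this

theorem norm_pv (q : Fin 3 → ℂ) (hq : ∀ i, q i = 0 ∨ q i = 1) (B C : Matrix (Fin 3) (Fin 3) ℂ)
    (h : (fromBlocks (diagonal q) B Bᴴ C).PosSemidef)
    (h' : (fromBlocks (diagonal q) Bᴴ B C).PosSemidef)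
    (h0 : ¬ (diagonal q = 0 ∧ B = 0 ∧ C = 0)) : PV (diagonal q) B C := by
  have h'' : (fromBlocks (diagonal q) Bᴴ Bᴴᴴ C).PosSemidef := by
    rwa [conjTranspose_conjTranspose]
  have r1 : ∀ i, q i = 0 → ∀ j, B i j = 0 := fun i hi j => zero_row q B C h i hi j
  have r2 : ∀ i, q i = 0 → ∀ j, Bᴴ i j = 0 := fun i hi j => zero_row q Bᴴ C h'' i hi j
  have aux : ∀ M : Matrix (Fin 3) (Fin 3) ℂ, (∀ i, q i = 0 → ∀ j, M i j = 0) →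
      diagonal q * M = M := by
    intro M hM
    ext i j
    rw [Matrix.diagonal_mul]
    rcases hq i with hi | hi
    · rw [hM i hi]; simp
    · rw [hi, one_mul]
  have hQB := aux B r1
  have hQB' := aux Bᴴ r2
  have hD1 := schur_psd q B C h hQB
  have hD2 := schur_psd q Bᴴ C h'' hQB'
  rw [conjTranspose_conjTranspose] at hD2
  have B0 : ∀ i, q i = 0 → B *ᵥ Pi.single i 1 = 0 := by
    intro i hi; ext j
    have := r2 i hi j
    simpa using this
  have B0' : ∀ i, q i = 0 → Bᴴ *ᵥ Pi.single i 1 = 0 := by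
    intro i hi; ext j
    have := r1 i hi j
    simpa using this
  by_cases hC : ∃ i, q i = 0 ∧ C *ᵥ Pi.single i 1 ≠ 0
  · obtain ⟨i, hi, hCi⟩ := hC
    refine ⟨0, 1, _, hCi, Or.inr one_ne_zero, ⟨0, Pi.single i 1, ?_, ?_⟩,
      ⟨0, Pi.single i 1, ?_, ?_⟩⟩
    · rw [B0 i hi]; simp
    · simp
    · rw [B0' i hi]; simp
    · simp
  push Not at hC
  set D1 := C - Bᴴ * B with hD1d
  set D2 := C - B * Bᴴ with hD2d
  by_cases hdisj : ∀ x y, D1 *ᵥ x = D2 *ᵥ y → D1 *ᵥ x = 0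
  swap
  · push Not at hdisj
    obtain ⟨x, y, hxy, hx⟩ := hdisj
    refine ⟨0, 1, _, hx, Or.inr one_ne_zero, ⟨-(B *ᵥ x), x, ?_, ?_⟩,
      ⟨-(Bᴴ *ᵥ y), y, ?_, ?_⟩⟩
    · rw [Matrix.mulVec_neg, Matrix.mulVec_mulVec, hQB]; simp
    · rw [Matrix.mulVec_neg, Matrix.mulVec_mulVec, hD1d, Matrix.sub_mulVec, one_smul]; abel
    · rw [Matrix.mulVec_neg, Matrix.mulVec_mulVec, hQB']; simp
    · rw [hxy, Matrix.mulVec_neg, Matrix.mulVec_mulVec, hD2d, Matrix.sub_mulVec, star_one,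
        one_smul]; abel
  have key : ∃ (w : ℂ) (f : Fin 3 → ℂ), f ≠ 0 ∧ (∀ i, q i = 0 → f i = 0) ∧
      (∃ g, B *ᵥ f - w • f = D2 *ᵥ g) ∧ (∃ g, Bᴴ *ᵥ f - star w • f = D1 *ᵥ g) := by
    have hZ : ∀ i, q i = 0 → (D2 - D1) *ᵥ Pi.single i 1 = 0 := by
      intro i hi
      rw [hD1d, hD2d, Matrix.sub_mulVec, Matrix.sub_mulVec, Matrix.sub_mulVec,
        ← Matrix.mulVec_mulVec, ← Matrix.mulVec_mulVec, B0 i hi, B0' i hi]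
      simp
    by_cases hdet : IsUnit (D2 - D1).det
    · obtain ⟨w, f, hf, h1, h2⟩ := pv_nonsing B D1 D2 hdet hdisj
      refine ⟨w, f, hf, fun i hi => ?_, h1, h2⟩
      exfalso
      have hd : (D2 - D1).det = 0 := Matrix.exists_mulVec_eq_zero_iff.1
        ⟨Pi.single i 1, by simp, hZ i hi⟩
      rw [hd] at hdet
      simp at hdet
    · have hd : (D2 - D1).det = 0 := by
        by_contra hne
        exact hdet (isUnit_iff_ne_zero.2 hne)
      obtain ⟨k, hk, hkk⟩ := Matrix.exists_mulVec_eq_zero_iff.2 hd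
      rw [Matrix.sub_mulVec, sub_eq_zero] at hkk
      have hi₀ : ∃ i, q i ≠ 0 := by
        by_contra! hall
        apply h0
        refine ⟨?_, ?_, ?_⟩
        · ext i j; simp [diagonal_apply, hall]
        · ext i j; exact r1 i (hall i) j
        · exact Matrix.ext_of_mulVec_single fun i => by rw [hC i (hall i), Matrix.zero_mulVec]
      obtain ⟨i₀, hi₀⟩ := hi₀
      obtain ⟨w, f, hf, hfZ, h1, h2⟩ := pv_sing B D1 D2 hD1 hD2 (by rw [hD1d, hD2d]; abel) hdisj
        k hk hkk.symm {i | q i = 0} i₀ hi₀ (fun i hi => r1 i hi) (by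
          intro i hi
          have e : D2 *ᵥ Pi.single i 1 = 0 := by
            rw [hD2d, Matrix.sub_mulVec, hC i hi, ← Matrix.mulVec_mulVec, B0' i hi]
            simp
          have := congrFun e i
          simpa using this)
      exact ⟨w, f, hf, hfZ, h1, h2⟩
  obtain ⟨w, f, hf, hfZ, ⟨g, hg⟩, ⟨g', hg'⟩⟩ := key
  have hQf : diagonal q *ᵥ f = f := by
    ext i
    rw [Matrix.mulVec_diagonal]
    rcases hq i with hi | hi
    · rw [hfZ i hi]; simp
    · rw [hi, one_mul]
  refine ⟨1, star w, f, hf, Or.inl one_ne_zero, ⟨f + B *ᵥ g', -g', ?_, ?_⟩,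
    ⟨f + Bᴴ *ᵥ g, -g, ?_, ?_⟩⟩
  · rw [Matrix.mulVec_add, hQf, Matrix.mulVec_mulVec, hQB, Matrix.mulVec_neg]; simp
  · rw [hD1d, Matrix.sub_mulVec] at hg'
    rw [Matrix.mulVec_add, Matrix.mulVec_mulVec, Matrix.mulVec_neg]
    rw [sub_eq_iff_eq_add] at hg'
    rw [hg']; abel
  · rw [Matrix.mulVec_add, hQf, Matrix.mulVec_mulVec, hQB', Matrix.mulVec_neg]; simp
  · rw [hD2d, Matrix.sub_mulVec] at hg
    rw [Matrix.mulVec_add, Matrix.mulVec_mulVec, Matrix.mulVec_neg]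
    rw [sub_eq_iff_eq_add] at hg
    rw [hg, star_star]; abel

theorem exists_T (A : Matrix (Fin 3) (Fin 3) ℂ) (hA : A.PosSemidef) :
    ∃ (T : Matrix (Fin 3) (Fin 3) ℂ) (q : Fin 3 → ℂ), IsUnit T.det ∧
      (∀ i, q i = 0 ∨ q i = 1) ∧ Tᴴ * A * T = diagonal q := by
  have hsp := hA.isHermitian.conjStarAlgAut_star_eigenvectorUnitary
  rw [Unitary.conjStarAlgAut_star_apply] at hsp
  set U : Matrix (Fin 3) (Fin 3) ℂ := hA.isHermitian.eigenvectorUnitary.1 with hU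
  set l := hA.isHermitian.eigenvalues with hl
  have hl0 : ∀ i, 0 ≤ l i := hA.eigenvalues_nonneg
  let s : Fin 3 → ℝ := fun i => if l i = 0 then 1 else (Real.sqrt (l i))⁻¹
  have hUd : U.det ≠ 0 := by
    have : star U * U = 1 := Unitary.coe_star_mul_self _
    intro h0
    have := congrArg Matrix.det this
    rw [Matrix.det_mul, h0] at this
    simp at this
  refine ⟨U * diagonal (fun i => (s i : ℂ)), fun i => ((s i * l i * s i : ℝ) : ℂ), ?_, ?_, ?_⟩
  · rw [Matrix.det_mul, Matrix.det_diagonal, isUnit_iff_ne_zero]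
    refine mul_ne_zero hUd (Finset.prod_ne_zero_iff.2 fun i _ => ?_)
    have : s i ≠ 0 := by
      by_cases h : l i = 0
      · simp [s, h]
      · have := Real.sqrt_pos.2 (lt_of_le_of_ne (hl0 i) (Ne.symm h))
        simp [s, h, this.ne']
    exact_mod_cast this
  · intro i
    by_cases h : l i = 0
    · left; simp [h]
    · right
      have h1 := Real.sqrt_pos.2 (lt_of_le_of_ne (hl0 i) (Ne.symm h))
      have h2 := Real.mul_self_sqrt (hl0 i)
      have : s i * l i * s i = 1 := by
        simp only [s, h, if_false]
        field_simp
        nlinarith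
      show ((s i * l i * s i : ℝ) : ℂ) = 1
      rw [this]; simp
  · rw [conjTranspose_mul]
    have : (diagonal fun i => (s i : ℂ))ᴴ * Uᴴ * A * (U * diagonal fun i => (s i : ℂ))
      = (diagonal fun i => (s i : ℂ))ᴴ * (star U * A * U) * diagonal fun i => (s i : ℂ) := by
      simp only [Matrix.mul_assoc, star_eq_conjTranspose]
    rw [this, hsp, diagonal_conjTranspose, diagonal_mul_diagonal, diagonal_mul_diagonal]
    congr 1
    ext i
    simp

theorem pv_exists (A B C : Matrix (Fin 3) (Fin 3) ℂ)
    (h : (fromBlocks A B Bᴴ C).PosSemidef) (h' : (fromBlocks A Bᴴ B C).PosSemidef)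
    (h0 : ¬ (A = 0 ∧ B = 0 ∧ C = 0)) : PV A B C := by
  have hA : A.PosSemidef := by
    have := h.submatrix (Sum.inl : Fin 3 → Fin 3 ⊕ Fin 3)
    exact this
  obtain ⟨T, q, hT, hq, hTA⟩ := exists_T A hA
  have hT' : IsUnit (Tᴴ).det := by rw [det_conjTranspose]; exact hT.star
  have c1 : Tᴴ⁻¹ * Tᴴ = 1 := Matrix.nonsing_inv_mul _ hT'
  have c2 : T * T⁻¹ = 1 := Matrix.mul_nonsing_inv _ hT
  have e : ∀ B' : Matrix (Fin 3) (Fin 3) ℂ, (fromBlocks A B' B'ᴴ C).PosSemidef →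
      (fromBlocks (diagonal q) (Tᴴ * B' * T) (Tᴴ * B' * T)ᴴ (Tᴴ * C * T)).PosSemidef := by
    intro B' hB'
    have := hB'.conjTranspose_mul_mul_same (fromBlocks T 0 0 T)
    convert this using 1
    rw [fromBlocks_conjTranspose, fromBlocks_multiply, fromBlocks_multiply]
    simp [hTA, conjTranspose_mul, Matrix.mul_assoc]
  have e2 := e Bᴴ (by rwa [conjTranspose_conjTranspose])
  have c3 : (Tᴴ * Bᴴ * T)ᴴ = Tᴴ * B * T := by simp [conjTranspose_mul, Matrix.mul_assoc]
  have c4 : (Tᴴ * B * T)ᴴ = Tᴴ * Bᴴ * T := by simp [conjTranspose_mul, Matrix.mul_assoc]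
  rw [c3, ← c4] at e2
  have back : ∀ M, Tᴴ * M * T = 0 → M = 0 := by
    intro M hM
    have : M = Tᴴ⁻¹ * (Tᴴ * M * T) * T⁻¹ := by
      rw [← Matrix.mul_assoc, ← Matrix.mul_assoc, c1, Matrix.one_mul, Matrix.mul_assoc, c2,
        Matrix.mul_one]
    rw [this, hM]; simp
  obtain ⟨a, b, f, hf, hab, ⟨x, y, h1, h2⟩, ⟨x', y', h3, h4⟩⟩ :=
    norm_pv q hq (Tᴴ * B * T) (Tᴴ * C * T) (e B h) e2 (by
      rintro ⟨z1, z2, z3⟩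
      exact h0 ⟨back _ (hTA.trans z1), back _ z2, back _ z3⟩)
  have tr : ∀ (M N : Matrix (Fin 3) (Fin 3) ℂ) (x y : Fin 3 → ℂ) (c : ℂ),
      (Tᴴ * M * T) *ᵥ x + (Tᴴ * N * T) *ᵥ y = c • f →
      M *ᵥ (T *ᵥ x) + N *ᵥ (T *ᵥ y) = c • (Tᴴ⁻¹ *ᵥ f) := by
    intro M N x y c hc
    rw [← Matrix.mulVec_smul, ← hc, Matrix.mulVec_add]
    simp only [Matrix.mulVec_mulVec]
    rw [← Matrix.mul_assoc, ← Matrix.mul_assoc, ← Matrix.mul_assoc, ← Matrix.mul_assoc, c1,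
      Matrix.one_mul, Matrix.one_mul]
  rw [← hTA] at h1 h3
  rw [c4] at h2 h3
  refine ⟨a, b, Tᴴ⁻¹ *ᵥ f, ?_, hab, ⟨_, _, tr _ _ _ _ _ h1, tr _ _ _ _ _ h2⟩,
    ⟨_, _, tr _ _ _ _ _ h3, tr _ _ _ _ _ h4⟩⟩
  intro hz
  have : Tᴴ *ᵥ (Tᴴ⁻¹ *ᵥ f) = f := by
    rw [Matrix.mulVec_mulVec, Matrix.mul_nonsing_inv _ hT', Matrix.one_mulVec]
  rw [hz, Matrix.mulVec_zero] at this
  exact hf this.symm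

theorem sub_small {n : Type} [Fintype n] [DecidableEq n] {D : Matrix n n ℂ} (hD : D.PosSemidef)
    (x : n → ℂ) : ∃ ε : ℝ, 0 < ε ∧ ∀ δ : ℝ, 0 ≤ δ → δ ≤ ε →
      (D - (δ : ℂ) • vecMulVec (D *ᵥ x) (star (D *ᵥ x))).PosSemidef := by
  obtain ⟨t, ht⟩ : ∃ t : ℝ, star x ⬝ᵥ (D *ᵥ x) = t :=
    ⟨(star x ⬝ᵥ (D *ᵥ x)).re, (Complex.eq_re_of_ofReal_le (hD.dotProduct_mulVec_nonneg x))⟩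
  have ht0 : 0 ≤ t := by
    have := hD.dotProduct_mulVec_nonneg x
    rw [ht] at this
    exact_mod_cast this
  set V := vecMulVec (D *ᵥ x) (star (D *ᵥ x)) with hV
  have hVp : V.PosSemidef := posSemidef_vecMulVec_self_star _
  have hV1 : D * vecMulVec x (star (D *ᵥ x)) = V := by
    rw [Matrix.mul_vecMulVec]
  have hV2 : vecMulVec (D *ᵥ x) (star x) * D = V := by
    rw [Matrix.vecMulVec_mul, hV, Matrix.star_mulVec, hD.isHermitian.eq]
  have hV3 : V * vecMulVec x (star (D *ᵥ x)) = (t : ℂ) • V := by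
    rw [hV, Matrix.vecMulVec_mul_vecMulVec, ← psd_symm hD, ht]
    ext i j
    simp [vecMulVec_apply]
    try ring
  set s : ℝ := 1 / (1 + t) with hs
  have hs0 : 0 < s := by positivity
  have hst : s * t < 1 := by rw [hs]; field_simp; linarith
  have hmain : (D - ((2 * s - s ^ 2 * t : ℝ) : ℂ) • V).PosSemidef := by
    have := hD.conjTranspose_mul_mul_same (1 - (s : ℂ) • vecMulVec x (star (D *ᵥ x)))
    convert this using 1
    rw [conjTranspose_sub, conjTranspose_smul, conjTranspose_one, conjTranspose_vecMulVec,
      star_star]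
    rw [Matrix.sub_mul, Matrix.smul_mul, hV2, Matrix.mul_sub, Matrix.sub_mul, Matrix.sub_mul,
      Matrix.mul_smul, Matrix.one_mul, Matrix.mul_one, Matrix.smul_mul, Matrix.mul_smul, hV1,
      Matrix.smul_mul, hV3, Matrix.mul_one]
    ext i j
    simp
    ring
  refine ⟨2 * s - s ^ 2 * t, by nlinarith, fun δ h0 h1 => ?_⟩
  have h2 : ((2 * s - s ^ 2 * t - δ : ℝ) : ℂ) • V = ((2 * s - s ^ 2 * t - δ : ℝ) : ℂ) • V := rfl
  have h3 : (((2 * s - s ^ 2 * t - δ : ℝ) : ℂ) • V).PosSemidef := by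
    apply hVp.smul
    have : 0 ≤ 2 * s - s ^ 2 * t - δ := by linarith
    exact_mod_cast this
  convert hmain.add h3 using 1
  ext i j
  simp
  ring

theorem closed_aux {n : Type} [Fintype n] {D V : Matrix n n ℂ} (hD : D.PosSemidef)
    (hV : V.PosSemidef) : IsClosed {l : ℝ | (D - (l : ℂ) • V).PosSemidef} := by
  have : {l : ℝ | (D - (l : ℂ) • V).PosSemidef} =
      ⋂ x : n → ℂ, {l : ℝ | 0 ≤ star x ⬝ᵥ ((D - (l : ℂ) • V) *ᵥ x)} := by
    ext l
    simp only [Set.mem_ofPred_eq, Set.mem_iInter]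
    constructor
    · intro h x; exact h.dotProduct_mulVec_nonneg x
    · intro h
      refine Matrix.PosSemidef.of_dotProduct_mulVec_nonneg ?_ h
      refine hD.isHermitian.sub ?_
      rw [IsHermitian, conjTranspose_smul, hV.isHermitian.eq]
      simp
  rw [this]
  refine isClosed_iInter fun x => ?_
  refine isClosed_le continuous_const ?_
  simp only [Matrix.sub_mulVec, Matrix.smul_mulVec, dotProduct_sub, dotProduct_smul]
  fun_prop

theorem rank_aux {n : Type} [Fintype n] [DecidableEq n] (D : Matrix n n ℂ) (x : n → ℂ) (c : ℂ) :
    (D - c • vecMulVec (D *ᵥ x) (star (D *ᵥ x))).rank ≤ D.rank ∧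
    ((∀ y, (D - c • vecMulVec (D *ᵥ x) (star (D *ᵥ x))) *ᵥ y ≠ D *ᵥ x) →
      (D - c • vecMulVec (D *ᵥ x) (star (D *ᵥ x))).rank < D.rank) := by
  set E := D - c • vecMulVec (D *ᵥ x) (star (D *ᵥ x)) with hE
  have hle : LinearMap.range E.mulVecLin ≤ LinearMap.range D.mulVecLin := by
    rintro _ ⟨y, rfl⟩
    refine ⟨y - (c * (star (D *ᵥ x) ⬝ᵥ y)) • x, ?_⟩
    simp only [Matrix.mulVecLin_apply]
    rw [hE, Matrix.sub_mulVec, Matrix.smul_mulVec, Matrix.vecMulVec_mulVec, Matrix.mulVec_sub,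
      Matrix.mulVec_smul]
    ext i
    simp
    ring
  refine ⟨Submodule.finrank_mono hle, fun h => ?_⟩
  refine Submodule.finrank_lt_finrank_of_lt (lt_of_le_of_ne hle fun heq => ?_)
  have : D *ᵥ x ∈ LinearMap.range E.mulVecLin := by rw [heq]; exact ⟨x, rfl⟩
  obtain ⟨y, hy⟩ := this
  exact h y hy

theorem max_sub {n : Type} [Fintype n] [DecidableEq n] {D D' : Matrix n n ℂ} (hD : D.PosSemidef)
    (hD' : D'.PosSemidef) (v v' x x' : n → ℂ) (hv : v = D *ᵥ x) (hv' : v' = D' *ᵥ x')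
    (hv0 : v ≠ 0) :
    ∃ l : ℝ, 0 ≤ l ∧ (D - (l : ℂ) • vecMulVec v (star v)).PosSemidef ∧
      (D' - (l : ℂ) • vecMulVec v' (star v')).PosSemidef ∧
      (D - (l : ℂ) • vecMulVec v (star v)).rank + (D' - (l : ℂ) • vecMulVec v' (star v')).rank
        < D.rank + D'.rank := by
  set V := vecMulVec v (star v) with hV
  set V' := vecMulVec v' (star v') with hV'
  have hVp : V.PosSemidef := posSemidef_vecMulVec_self_star _
  have hVp' : V'.PosSemidef := posSemidef_vecMulVec_self_star _
  let S : Set ℝ := {l | 0 ≤ l} ∩ ({l : ℝ | (D - (l : ℂ) • V).PosSemidef} ∩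
    {l : ℝ | (D' - (l : ℂ) • V').PosSemidef})
  have hScl : IsClosed S :=
    (isClosed_le continuous_const continuous_id).inter ((closed_aux hD hVp).inter
      (closed_aux hD' hVp'))
  have hSne : S.Nonempty := ⟨0, by simp [S, hD, hD']⟩
  have hpos : 0 < star v ⬝ᵥ v := Matrix.dotProduct_star_self_pos_iff.2 hv0
  obtain ⟨c, hc⟩ : ∃ c : ℝ, star v ⬝ᵥ v = c :=
    ⟨(star v ⬝ᵥ v).re, Complex.eq_re_of_ofReal_le hpos.le⟩
  have hcpos : 0 < c := by rw [hc] at hpos; exact_mod_cast hpos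
  obtain ⟨d, hd⟩ : ∃ d : ℝ, star v ⬝ᵥ (D *ᵥ v) = d :=
    ⟨(star v ⬝ᵥ (D *ᵥ v)).re, (Complex.eq_re_of_ofReal_le (hD.dotProduct_mulVec_nonneg v))⟩
  have hSb : BddAbove S := by
    refine ⟨d / c ^ 2, ?_⟩
    rintro l ⟨hl0, hl1, -⟩
    have := Matrix.PosSemidef.dotProduct_mulVec_nonneg hl1 v
    rw [Matrix.sub_mulVec, Matrix.smul_mulVec, hV, Matrix.vecMulVec_mulVec, dotProduct_sub, hd,
      hc, dotProduct_smul] at this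
    simp only [op_smul_eq_smul, dotProduct_smul, hc, smul_eq_mul] at this
    have h2 : (0 : ℝ) ≤ d - l * (c * c) := by exact_mod_cast this
    rw [le_div_iff₀ (by positivity)]
    nlinarith
  have hmem := hScl.csSup_mem hSne hSb
  set l := sSup S with hl
  obtain ⟨hl0, hl1, hl2⟩ := hmem
  refine ⟨l, hl0, hl1, hl2, ?_⟩
  have r1 := rank_aux D x l
  have r2 := rank_aux D' x' l
  rw [← hv, ← hV] at r1
  rw [← hv', ← hV'] at r2
  by_cases h1 : ∃ y, (D - (l : ℂ) • V) *ᵥ y = v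
  · by_cases h2 : ∃ y, (D' - (l : ℂ) • V') *ᵥ y = v'
    · exfalso
      obtain ⟨y, hy⟩ := h1
      obtain ⟨y', hy'⟩ := h2
      obtain ⟨ε, hε, h3⟩ := sub_small hl1 y
      obtain ⟨ε', hε', h3'⟩ := sub_small hl2 y'
      rw [hy, ← hV] at h3
      rw [hy', ← hV'] at h3'
      have m0 : 0 < min ε ε' := lt_min hε hε'
      have : l + min ε ε' ∈ S := by
        refine ⟨add_nonneg hl0 m0.le, ?_, ?_⟩
        · have := h3 _ m0.le (min_le_left _ _)
          rw [sub_sub, ← add_smul] at this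
          show (D - ((l + min ε ε' : ℝ) : ℂ) • V).PosSemidef
          rw [Complex.ofReal_add]
          exact this
        · have := h3' _ m0.le (min_le_right _ _)
          rw [sub_sub, ← add_smul] at this
          show (D' - ((l + min ε ε' : ℝ) : ℂ) • V').PosSemidef
          rw [Complex.ofReal_add]
          exact this
      have := le_csSup hSb this
      linarith
    · have := r2.2 (fun y hy => h2 ⟨y, hy⟩)
      have := r1.1
      omega
  · have := r1.2 (fun y hy => h1 ⟨y, hy⟩)
    have := r2.1
    omega

inductive SepT : Matrix (Fin 3) (Fin 3) ℂ → Matrix (Fin 3) (Fin 3) ℂ →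
    Matrix (Fin 3) (Fin 3) ℂ → Prop
  | zero : SepT 0 0 0
  | step (A B C : Matrix (Fin 3) (Fin 3) ℂ) (a b : ℂ) (f : Fin 3 → ℂ) (h : SepT A B C) :
      SepT (A + (a * star a) • vecMulVec f (star f)) (B + (a * star b) • vecMulVec f (star f))
        (C + (b * star b) • vecMulVec f (star f))

theorem blk (A B C : Matrix (Fin 3) (Fin 3) ℂ) (a b l : ℂ) (f : Fin 3 → ℂ) (hl : star l = l) :
    fromBlocks A B Bᴴ C - l • vecMulVec (Sum.elim (a • f) (b • f)) (star (Sum.elim (a • f) (b • f)))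
    = fromBlocks (A - (l * (a * star a)) • vecMulVec f (star f))
        (B - (l * (a * star b)) • vecMulVec f (star f))
        (B - (l * (a * star b)) • vecMulVec f (star f))ᴴ
        (C - (l * (b * star b)) • vecMulVec f (star f)) := by
  ext i j
  rcases i with i | i <;> rcases j with j | j <;>
    simp [vecMulVec_apply] <;> simp at hl <;> (try rw [hl]) <;> ring

theorem sepT_of_ppt : ∀ (N : ℕ) (A B C : Matrix (Fin 3) (Fin 3) ℂ),
    (fromBlocks A B Bᴴ C).PosSemidef → (fromBlocks A Bᴴ B C).PosSemidef →
    (fromBlocks A B Bᴴ C).rank + (fromBlocks A Bᴴ B C).rank ≤ N → SepT A B C := by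
  intro N
  induction N using Nat.strong_induction_on with
  | _ N ih =>
  intro A B C h h' hN
  by_cases h0 : A = 0 ∧ B = 0 ∧ C = 0
  · obtain ⟨rfl, rfl, rfl⟩ := h0
    exact SepT.zero
  obtain ⟨a, b, f, hf, hab, ⟨x, y, h1, h2⟩, ⟨x', y', h3, h4⟩⟩ := pv_exists A B C h h' h0
  have hv : Sum.elim (a • f) (b • f) = fromBlocks A B Bᴴ C *ᵥ Sum.elim x y := by
    rw [Matrix.fromBlocks_mulVec]; simp [h1, h2]
  have hv' : Sum.elim (star a • f) (star b • f) = fromBlocks A Bᴴ B C *ᵥ Sum.elim x' y' := by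
    rw [Matrix.fromBlocks_mulVec]; simp only [Sum.elim_comp_inl, Sum.elim_comp_inr, h3, h4]
  have hv0 : Sum.elim (a • f) (b • f) ≠ 0 := by
    intro hz
    have z1 : a • f = 0 := by ext i; exact congrFun hz (Sum.inl i)
    have z2 : b • f = 0 := by ext i; exact congrFun hz (Sum.inr i)
    rcases hab with q | q
    · exact (smul_eq_zero.1 z1).elim q hf
    · exact (smul_eq_zero.1 z2).elim q hf
  obtain ⟨l, hl0, g1, g2, g3⟩ := max_sub h h' _ _ _ _ hv hv' hv0
  have hstar : star (l : ℂ) = l := by simp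
  have b1 := blk A B C a b l f hstar
  have b2 := blk A Bᴴ C (star a) (star b) l f hstar
  set A1 := A - ((l : ℂ) * (a * star a)) • vecMulVec f (star f) with hA1
  set B1 := B - ((l : ℂ) * (a * star b)) • vecMulVec f (star f) with hB1
  set C1 := C - ((l : ℂ) * (b * star b)) • vecMulVec f (star f) with hC1
  have e1 : Bᴴ - ((l : ℂ) * (star a * star (star b))) • vecMulVec f (star f) = B1ᴴ := by
    ext i j
    simp [hB1, vecMulVec_apply]
    left; ring
  have e2 : A - ((l : ℂ) * (star a * star (star a))) • vecMulVec f (star f) = A1 := by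
    rw [hA1, star_star, mul_comm a]
  have e3 : C - ((l : ℂ) * (star b * star (star b))) • vecMulVec f (star f) = C1 := by
    rw [hC1, star_star, mul_comm b]
  rw [e1, e2, e3] at b2
  simp only [conjTranspose_conjTranspose] at b2
  rw [b1] at g1 g3
  rw [b2] at g2 g3
  have hS := ih _ (lt_of_lt_of_le g3 hN) A1 B1 C1 g1 g2 le_rfl
  have := SepT.step A1 B1 C1 a b ((Real.sqrt l : ℂ) • f) hS
  have hss : ((Real.sqrt l : ℝ) : ℂ) * (Real.sqrt l : ℝ) = l := by
    rw [← Complex.ofReal_mul, Real.mul_self_sqrt hl0]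
  have hP : vecMulVec ((Real.sqrt l : ℂ) • f) (star ((Real.sqrt l : ℂ) • f))
      = (l : ℂ) • vecMulVec f (star f) := by
    rw [← hss]
    ext i j
    simp [vecMulVec_apply]
    ring
  rw [hP] at this
  simp only [smul_smul] at this
  convert this using 1
  · rw [hA1, mul_comm (l : ℂ)]; abel
  · rw [hB1, mul_comm (l : ℂ)]; abel
  · rw [hC1, mul_comm (l : ℂ)]; abel

def SepM {m n : Type} (E : Matrix (m × n) (m × n) ℂ) : Prop :=
  ∃ (N : ℕ) (a : Fin N → m → ℂ) (b : Fin N → n → ℂ), ∀ p q,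
    E p q = ∑ l, (a l p.1 * b l p.2) * star (a l q.1 * b l q.2)

theorem SepM.of_fintype {m n ι : Type} [Fintype ι] {E : Matrix (m × n) (m × n) ℂ}
    (a : ι → m → ℂ) (b : ι → n → ℂ)
    (h : ∀ p q, E p q = ∑ l, (a l p.1 * b l p.2) * star (a l q.1 * b l q.2)) : SepM E := by
  refine ⟨Fintype.card ι, fun l => a ((Fintype.equivFin ι).symm l),
    fun l => b ((Fintype.equivFin ι).symm l), fun p q => ?_⟩
  rw [h]
  exact ((Fintype.equivFin ι).symm.sum_comp
    (fun l => (a l p.1 * b l p.2) * star (a l q.1 * b l q.2))).symm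

theorem SepM.submatrix {m n m' n' : Type} {E : Matrix (m × n) (m × n) ℂ} (h : SepM E)
    (s : m' → m) (t : n' → n) : SepM (E.submatrix (Prod.map s t) (Prod.map s t)) := by
  obtain ⟨N, a, b, hE⟩ := h
  exact ⟨N, fun l => a l ∘ s, fun l => b l ∘ t, fun p q => by
    rw [Matrix.submatrix_apply, hE]; rfl⟩

theorem SepM.swap {m n : Type} {E : Matrix (m × n) (m × n) ℂ} (h : SepM E) :
    SepM (E.submatrix Prod.swap Prod.swap) := by
  obtain ⟨N, a, b, hE⟩ := h
  exact ⟨N, b, a, fun p q => by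
    rw [Matrix.submatrix_apply, hE]
    refine Finset.sum_congr rfl fun l _ => ?_
    simp only [Prod.fst_swap, Prod.snd_swap]
    rw [mul_comm (a l p.2), mul_comm (a l q.2)]⟩

theorem sepT_sum {A B C : Matrix (Fin 3) (Fin 3) ℂ} (h : SepT A B C) :
    ∃ (N : ℕ) (a b : Fin N → ℂ) (f : Fin N → Fin 3 → ℂ),
      (∀ i j, A i j = ∑ l, (a l * f l i) * star (a l * f l j)) ∧
      (∀ i j, B i j = ∑ l, (a l * f l i) * star (b l * f l j)) ∧
      (∀ i j, C i j = ∑ l, (b l * f l i) * star (b l * f l j)) := by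
  induction h with
  | zero => exact ⟨0, 0, 0, 0, by simp, by simp, by simp⟩
  | step A B C a b f _ ih =>
    obtain ⟨N, a', b', f', h1, h2, h3⟩ := ih
    refine ⟨N + 1, Fin.cons a a', Fin.cons b b', Fin.cons f f', ?_, ?_, ?_⟩ <;> intro i j <;>
      rw [Fin.sum_univ_succ] <;>
      simp only [Fin.cons_zero, Fin.cons_succ, Matrix.add_apply, Matrix.smul_apply,
        vecMulVec_apply, h1, h2, h3, smul_eq_mul, star_mul', Pi.star_apply] <;> ring

theorem sep23 (E : Matrix (Fin 2 × Fin 3) (Fin 2 × Fin 3) ℂ) (hE : E.PosSemidef)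
    (hP : (partialTransposeA E).PosSemidef) : SepM E := by
  let φ : Fin 3 ⊕ Fin 3 → Fin 2 × Fin 3 := Sum.elim (fun i => (0, i)) (fun i => (1, i))
  let A : Matrix (Fin 3) (Fin 3) ℂ := fun i j => E (0, i) (0, j)
  let B : Matrix (Fin 3) (Fin 3) ℂ := fun i j => E (0, i) (1, j)
  let C : Matrix (Fin 3) (Fin 3) ℂ := fun i j => E (1, i) (1, j)
  have hB : ∀ i j, Bᴴ i j = E (1, i) (0, j) := fun i j => hE.isHermitian.apply _ _
  have e1 : fromBlocks A B Bᴴ C = E.submatrix φ φ := by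
    ext i j
    rcases i with i | i <;> rcases j with j | j
    · rfl
    · rfl
    · exact hB i j
    · rfl
  have e2 : fromBlocks A Bᴴ B C = (partialTransposeA E).submatrix φ φ := by
    ext i j
    rcases i with i | i <;> rcases j with j | j
    · rfl
    · exact hB i j
    · rfl
    · rfl
  have h1 : (fromBlocks A B Bᴴ C).PosSemidef := by rw [e1]; exact hE.submatrix φ
  have h2 : (fromBlocks A Bᴴ B C).PosSemidef := by rw [e2]; exact hP.submatrix φ
  obtain ⟨N, a, b, f, hA, hBB, hC⟩ := sepT_sum (sepT_of_ppt _ A B C h1 h2 le_rfl)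
  refine ⟨N, fun l => ![a l, b l], f, ?_⟩
  rintro ⟨i, j⟩ ⟨i', j'⟩
  fin_cases i <;> fin_cases i'
  · exact hA j j'
  · exact hBB j j'
  · have := hB j j'
    rw [Matrix.conjTranspose_apply, hBB, star_sum] at this
    refine this.symm.trans (Finset.sum_congr rfl fun l _ => ?_)
    rw [star_mul, star_star]
    rfl
  · exact hC j j'

open scoped MatrixOrder in
theorem sep_one {n : ℕ} (E : Matrix (Fin 1 × Fin n) (Fin 1 × Fin n) ℂ) (hE : E.PosSemidef) :
    SepM E := by
  obtain ⟨M, hM⟩ := CStarAlgebra.nonneg_iff_eq_star_mul_self.1 hE.nonneg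
  refine SepM.of_fintype (fun _ _ => 1) (fun k j => star (M k (0, j))) ?_
  rintro ⟨i, j⟩ ⟨i', j'⟩
  have hi : i = 0 := Subsingleton.elim _ _
  have hi' : i' = 0 := Subsingleton.elim _ _
  subst hi hi'
  rw [hM, Matrix.mul_apply]
  simp

theorem sep_core {dA dB : ℕ} (h : dA ≤ 1 ∨ (dA ≤ 2 ∧ dB ≤ 3))
    (E : Matrix (Fin dA × Fin dB) (Fin dA × Fin dB) ℂ) (hE : E.PosSemidef)
    (hP : (partialTransposeA E).PosSemidef) : SepM E := by
  rcases Nat.eq_zero_or_pos dA with rfl | hA0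
  · exact ⟨0, Fin.elim0, Fin.elim0, fun p => p.1.elim0⟩
  rcases Nat.eq_zero_or_pos dB with rfl | hB0
  · exact ⟨0, Fin.elim0, Fin.elim0, fun p => p.2.elim0⟩
  rcases h with h | ⟨h2, h3⟩
  · obtain rfl : dA = 1 := by omega
    exact sep_one E hE
  let g : Fin 2 → Fin dA := fun i => ⟨min i (dA - 1), by omega⟩
  let k : Fin 3 → Fin dB := fun i => ⟨min i (dB - 1), by omega⟩
  have h4 := sep23 (E.submatrix (Prod.map g k) (Prod.map g k)) (hE.submatrix _) (by
    exact hP.submatrix (Prod.map g k))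
  have h5 := h4.submatrix (Fin.castLE h2) (Fin.castLE h3)
  convert h5 using 1
  have hid : ∀ p : Fin dA × Fin dB,
      Prod.map g k (Prod.map (Fin.castLE h2) (Fin.castLE h3) p) = p := by
    rintro ⟨i, j⟩
    refine Prod.ext (Fin.ext ?_) (Fin.ext ?_)
    · have := i.2
      simp [g]; omega
    · have := j.2
      simp [k]; omega
  ext p q
  simp only [Matrix.submatrix_apply, hid]

theorem sep_of_ppt {dA dB : ℕ} (hdim : dA * dB ≤ 6)
    (E : Matrix (Fin dA × Fin dB) (Fin dA × Fin dB) ℂ) (hE : E.PosSemidef)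
    (hP : (partialTransposeA E).PosSemidef) : SepM E := by
  by_cases h : dA ≤ 1 ∨ (dA ≤ 2 ∧ dB ≤ 3)
  · exact sep_core h E hE hP
  have h' : dB ≤ 1 ∨ (dB ≤ 2 ∧ dA ≤ 3) := by
    by_contra hc
    push Not at h hc
    have h1 : 2 ≤ dA := h.1
    have h2 : 2 ≤ dB := hc.1
    rcases Nat.lt_or_ge 2 dA with h3 | h3
    · rcases Nat.lt_or_ge 2 dB with h4 | h4
      · nlinarith
      · have := hc.2 h4
        nlinarith
    · have := h.2 h3
      nlinarith
  have := sep_core h' (E.submatrix Prod.swap Prod.swap) (hE.submatrix _) (by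
    exact hP.transpose.submatrix Prod.swap)
  exact this.swap

theorem ppt_of_sep {dA dB : ℕ} {E : Matrix (Fin dA × Fin dB) (Fin dA × Fin dB) ℂ}
    (h : SepM E) : (partialTransposeA E).PosSemidef := by
  obtain ⟨N, a, b, hE⟩ := h
  have : partialTransposeA E = ∑ l, vecMulVec (fun p : Fin dA × Fin dB => star (a l p.1) * b l p.2)
      (star (fun p : Fin dA × Fin dB => star (a l p.1) * b l p.2)) := by
    ext p q
    rw [Matrix.sum_apply]
    show E (q.1, p.2) (p.1, q.2) = _
    rw [hE]
    refine Finset.sum_congr rfl fun l _ => ?_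
    simp only [vecMulVec_apply, Pi.star_apply, star_mul', star_star]
    ring
  rw [this]
  exact posSemidef_sum _ fun l _ => posSemidef_vecMulVec_self_star _

theorem sep_of_op {dA dB : ℕ} {E : Matrix (Fin dA × Fin dB) (Fin dA × Fin dB) ℂ}
    (h : IsSeparableOperation
      (fun ρ : Matrix (Fin dA × Fin dB) (Fin dA × Fin dB) ℂ => E ⊙ ρ)) : SepM E := by
  obtain ⟨n, A, B, h1, -⟩ := h
  refine ⟨n, fun l => A l *ᵥ 1, fun l => B l *ᵥ 1, fun p q => ?_⟩
  have h2 := congrFun (congrFun (h1 (vecMulVec 1 (star 1))) p) q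
  have hk : ∀ l, (A l ⊗ₖ B l) *ᵥ 1 = fun p => (A l *ᵥ 1) p.1 * (B l *ᵥ 1) p.2 := by
    intro l
    ext p
    simp only [Matrix.mulVec, dotProduct, Matrix.kroneckerMap_apply, Pi.one_apply, mul_one]
    rw [Fintype.sum_prod_type, Finset.sum_mul_sum]
  have h3 : E p q = (E ⊙ (vecMulVec 1 (star 1))) p q := by
    simp [vecMulVec_apply]
  refine (h3.trans h2).trans ?_
  rw [Matrix.sum_apply]
  refine Finset.sum_congr rfl fun l _ => ?_
  rw [Matrix.mul_vecMulVec, Matrix.vecMulVec_mul, ← Matrix.star_mulVec, vecMulVec_apply, hk,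
    Pi.star_apply]

theorem op_of_sep {dA dB : ℕ} {E : Matrix (Fin dA × Fin dB) (Fin dA × Fin dB) ℂ}
    (hdiag : ∀ i, E i i = 1) (h : SepM E) : IsSeparableOperation
      (fun ρ : Matrix (Fin dA × Fin dB) (Fin dA × Fin dB) ℂ => E ⊙ ρ) := by
  obtain ⟨n, a, b, hE⟩ := h
  refine ⟨n, fun l => diagonal (a l), fun l => diagonal (b l), fun ρ => ?_, ?_⟩
  · ext p q
    simp only [Matrix.diagonal_kronecker_diagonal, Matrix.sum_apply, diagonal_conjTranspose,
      Matrix.mul_diagonal, Matrix.diagonal_mul, Matrix.hadamard_apply, Pi.star_apply]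
    rw [hE, Finset.sum_mul]
    exact Finset.sum_congr rfl fun l _ => by ring
  · simp only [Matrix.diagonal_kronecker_diagonal, diagonal_conjTranspose,
      Matrix.diagonal_mul_diagonal]
    ext p q
    rw [Matrix.sum_apply]
    by_cases hpq : p = q
    · subst hpq
      simp only [diagonal_apply_eq, Matrix.one_apply_eq, Pi.star_apply]
      rw [← hdiag p, hE]
      exact Finset.sum_congr rfl fun l _ => by ring
    · simp [hpq]

end SW

/-- Corollary 1: Suppose `dA * dB ≤ 6` and `E` is positive semidefinite
with unit diagonal. The population-preserving CPTP map `Φ ρ = E ⊙ ρ` is a separable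
operation if and only if the partial transpose `E^{T_A}` is positive semidefinite. -/
theorem schur_multiplier_separable_operation_iff_ppt
    (dA dB : ℕ) (hdim : dA * dB ≤ 6)
    (E : Matrix (Fin dA × Fin dB) (Fin dA × Fin dB) ℂ)
    (hE : E.PosSemidef) (hdiag : ∀ i, E i i = 1) :
    IsSeparableOperation (fun ρ : Matrix (Fin dA × Fin dB) (Fin dA × Fin dB) ℂ => E ⊙ ρ)
    ↔ (partialTransposeA E).PosSemidef := by
  constructor
  · exact fun h => SW.ppt_of_sep (SW.sep_of_op h)
  · exact fun h => SW.op_of_sep hdiag (SW.sep_of_ppt hdim E hE h)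
end

section
/- (Peres–Horodecki necessity, PPT criterion.) If a complex matrix ρ indexed by Fin d_A × Fin d_B is separable, i.e. ρ = ∑_k σ_k ⊗ τ_k is a finite sum of Kronecker products of positive semidefinite matrices σ_k (d_A×d_A) and τ_k (d_B×d_B), then its partial transpose ρ^{T_A}, defined by (ρ^{T_A})_{(a,b),(a',b')} = ρ_{(a',b),(a,b')}, is positive semidefinite. -/
open Matrix BigOperators Kronecker
open scoped ComplexOrder

/-- Peres–Horodecki necessity, PPT criterion: if `ρ` is a finite sum of
Kronecker products of positive semidefinite matrices, then its partial transpose is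
positive semidefinite. -/
theorem partialTransposeA_posSemidef_of_separable
    (dA dB : ℕ) (ρ : Matrix (Fin dA × Fin dB) (Fin dA × Fin dB) ℂ)
    (hsep : ∃ (n : ℕ) (σ : Fin n → Matrix (Fin dA) (Fin dA) ℂ)
        (τ : Fin n → Matrix (Fin dB) (Fin dB) ℂ),
        (∀ k, (σ k).PosSemidef) ∧ (∀ k, (τ k).PosSemidef) ∧ ρ = ∑ k, σ k ⊗ₖ τ k) :
    (partialTransposeA ρ).PosSemidef := by
  obtain ⟨n, σ, τ, hσ, hτ, rfl⟩ := hsep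
  have h : partialTransposeA (∑ k, σ k ⊗ₖ τ k) = ∑ k, (σ k)ᵀ ⊗ₖ τ k := by
    ext i j
    simp [partialTransposeA, Matrix.sum_apply, Matrix.kroneckerMap_apply]
  rw [h]
  exact Matrix.posSemidef_sum _ fun k _ => (hσ k).transpose.kronecker (hτ k)
end

section
/- For every d ≥ 2, the SWAP channel Φ_U(ρ) = U ρ U†, where U is the swap unitary on matrices indexed by Fin d × Fin d, is not a separable operation: there is no Kraus representation Φ_U(ρ) = ∑_ℓ (A_ℓ ⊗ B_ℓ) ρ (A_ℓ ⊗ B_ℓ)† with ∑_ℓ (A_ℓ† A_ℓ) ⊗ (B_ℓ† B_ℓ) = I in which every Kraus operator is a Kronecker product of d×d matrices. -/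
open Matrix BigOperators Kronecker
open scoped ComplexOrder

/-- The swap unitary on `Fin d × Fin d`: `U_{(a,b),(a',b')} = δ_{a,b'} δ_{b,a'}`. -/
def swapU (d : ℕ) : Matrix (Fin d × Fin d) (Fin d × Fin d) ℂ :=
  fun i j => if i.1 = j.2 ∧ i.2 = j.1 then 1 else 0

lemma entry_aux {ι : Type*} [Fintype ι] [DecidableEq ι] (M : Matrix ι ι ℂ) (p p' q q' : ι) :
    (M * Matrix.single q q' (1:ℂ) * Mᴴ) p p' = M p q * star (M p' q') := by
  rw [Matrix.mul_apply, Finset.sum_eq_single q']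
  · simp [Matrix.mul_single_apply_same, Matrix.conjTranspose_apply]
  · intro b _ hb
    rw [Matrix.mul_single_apply_of_ne _ _ _ _ _ hb]
    simp
  · simp

/-- For every `d ≥ 2`, the SWAP channel `ρ ↦ U ρ Uᴴ` is not a separable
operation: it admits no Kraus representation with `∑ Kᴴ K = 1` in which every Kraus
operator is a Kronecker product `A ℓ ⊗ₖ B ℓ` of `d × d` matrices. -/
theorem swap_channel_not_separable_operation
    (d : ℕ) (hd : 2 ≤ d) :
    ¬ ∃ (n : ℕ) (A B : Fin n → Matrix (Fin d) (Fin d) ℂ),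
        (∀ ρ : Matrix (Fin d × Fin d) (Fin d × Fin d) ℂ,
          swapU d * ρ * (swapU d)ᴴ = ∑ ℓ, (A ℓ ⊗ₖ B ℓ) * ρ * (A ℓ ⊗ₖ B ℓ)ᴴ) ∧
        ∑ ℓ, (A ℓ ⊗ₖ B ℓ)ᴴ * (A ℓ ⊗ₖ B ℓ) = 1 := by
  rintro ⟨n, A, B, h, -⟩
  have key : ∀ p p' q q' : Fin d × Fin d, swapU d p q * star (swapU d p' q') =
      ∑ l, (A l p.1 q.1 * B l p.2 q.2) * star (A l p'.1 q'.1 * B l p'.2 q'.2) := by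
    intro p p' q q'
    have h1 := congrFun (congrFun (h (Matrix.single q q' 1)) p) p'
    rw [Matrix.sum_apply] at h1
    simp only [entry_aux, Matrix.kronecker_apply] at h1
    exact h1
  let x : Fin d := ⟨0, by omega⟩
  let y : Fin d := ⟨1, by omega⟩
  have hxy : x ≠ y := by simp [x, y]
  have h1 := key (x, x) (y, y) (x, x) (y, y)
  have h2 := key (x, y) (x, y) (x, y) (x, y)
  have hz : ∀ l, A l x x * B l y y = 0 := by
    have h3 : ∑ l, Complex.normSq (A l x x * B l y y) = 0 := by
      have h4 : (0:ℂ) = ∑ l, (A l x x * B l y y) * star (A l x x * B l y y) := by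
        rw [← h2]; simp [swapU, hxy]
      have h5 : ((∑ l, Complex.normSq (A l x x * B l y y) : ℝ) : ℂ) = 0 := by
        rw [h4, Complex.ofReal_sum]
        refine Finset.sum_congr rfl fun l _ => ?_
        exact (Complex.mul_conj _).symm
      exact_mod_cast h5
    intro l
    have h6 := (Finset.sum_eq_zero_iff_of_nonneg
      (fun l _ => Complex.normSq_nonneg (A l x x * B l y y))).1 h3 l (Finset.mem_univ l)
    exact Complex.normSq_eq_zero.1 h6
  have h7 : (1:ℂ) = 0 := by
    calc (1:ℂ) = _ := by simp [swapU]
      _ = _ := h1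
      _ = 0 := by
        refine Finset.sum_eq_zero fun l _ => ?_
        rcases mul_eq_zero.1 (hz l) with h | h <;> simp [h]
  exact one_ne_zero h7
end

section
/- Negativity of the gravitationally evolved two-path state: let Φ_{LL}, Φ_{LR}, Φ_{RL}, Φ_{RR} be real numbers and let ρ be the 4×4 complex matrix indexed by (a,b) ∈ {L,R} × {L,R} with entries ρ_{(a,b),(a',b')} = (1/4) exp(i(Φ_{ab} − Φ_{a'b'})) (a rank-one density matrix). Then the sum of the absolute values of the negative eigenvalues of the partial transpose ρ^{T_A}, defined by (ρ^{T_A})_{(a,b),(a',b')} = ρ_{(a',b),(a,b')}, equals (1/2) · |sin((Φ_{RL} + Φ_{LR} − Φ_{LL} − Φ_{RR})/2)|. -/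
open Matrix BigOperators
open scoped ComplexOrder

lemma neg_aux_det (z w : Fin 2 → Fin 2 → ℂ) (h : ∀ a b, z a b * w a b = 1) (x S : ℂ)
    (hS : S = (1 - (z 1 0 * z 0 1 * w 0 0 * w 1 1 + w 1 0 * w 0 1 * z 0 0 * z 1 1) / 2) / 2)
    (M : Matrix (Fin 2 × Fin 2) (Fin 2 × Fin 2) ℂ)
    (hM : ∀ a b a' b', M (a, b) (a', b') = 1 / 4 * (z a' b * w a b')) :
    (Matrix.scalar _ x - M).det = (x ^ 2 - x + S / 4) * (x ^ 2 - S / 4) := by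
  rw [← Matrix.det_submatrix_equiv_self (finProdFinEquiv (m := 2) (n := 2)).symm]
  have e0 : (finProdFinEquiv (m := 2) (n := 2)).symm (0 : Fin 4) = (0, 0) := by decide
  have e1 : (finProdFinEquiv (m := 2) (n := 2)).symm (1 : Fin 4) = (0, 1) := by decide
  have e2 : (finProdFinEquiv (m := 2) (n := 2)).symm (2 : Fin 4) = (1, 0) := by decide
  have e3 : (finProdFinEquiv (m := 2) (n := 2)).symm (3 : Fin 4) = (1, 1) := by decide
  have key : (Matrix.scalar _ x - M).submatrix (finProdFinEquiv (m := 2) (n := 2)).symm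
      (finProdFinEquiv (m := 2) (n := 2)).symm =
      (!![x - 1 / 4, -(1 / 4 * (z 0 0 * w 0 1)), -(1 / 4 * (z 1 0 * w 0 0)), -(1 / 4 * (z 1 0 * w 0 1));
        -(1 / 4 * (z 0 1 * w 0 0)), x - 1 / 4, -(1 / 4 * (z 1 1 * w 0 0)), -(1 / 4 * (z 1 1 * w 0 1));
        -(1 / 4 * (z 0 0 * w 1 0)), -(1 / 4 * (z 0 0 * w 1 1)), x - 1 / 4, -(1 / 4 * (z 1 0 * w 1 1));
        -(1 / 4 * (z 0 1 * w 1 0)), -(1 / 4 * (z 0 1 * w 1 1)), -(1 / 4 * (z 1 1 * w 1 0)), x - 1 / 4] :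
        Matrix (Fin 4) (Fin 4) ℂ) := by
    ext i j
    change Fin 4 at i j
    fin_cases i <;> fin_cases j <;>
      simp [e0, e1, e2, e3, hM, Matrix.scalar_apply, Matrix.diagonal_apply, h]
  rw [key, hS]
  have h00 := h 0 0
  have h01 := h 0 1
  have h10 := h 1 0
  have h11 := h 1 1
  clear key
  generalize z 0 0 = a at *
  generalize z 0 1 = b at *
  generalize z 1 0 = c at *
  generalize z 1 1 = d at *
  have ha : a ≠ 0 := left_ne_zero_of_mul_eq_one h00
  have hb : b ≠ 0 := left_ne_zero_of_mul_eq_one h01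
  have hc : c ≠ 0 := left_ne_zero_of_mul_eq_one h10
  have hd : d ≠ 0 := left_ne_zero_of_mul_eq_one h11
  rw [eq_inv_of_mul_eq_one_right h00, eq_inv_of_mul_eq_one_right h01,
    eq_inv_of_mul_eq_one_right h10, eq_inv_of_mul_eq_one_right h11]
  simp [Matrix.det_succ_row_zero, Fin.sum_univ_succ, Fin.succAbove, Matrix.submatrix]
  field_simp
  ring

/-- Negativity of the gravitationally evolved two-path state. The paths
are labelled by `Fin 2` with `L = 0`, `R = 1`, and `Φ_{ab} = f a b`. For the rank-one
density matrix `ρ_{(a,b),(a',b')} = (1/4) exp(i (Φ_{ab} - Φ_{a'b'}))`, the sum of the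
absolute values of the negative eigenvalues of the partial transpose `ρ^{T_A}` equals
`(1/2) |sin((Φ_{RL} + Φ_{LR} - Φ_{LL} - Φ_{RR})/2)|`. -/
theorem negativity_of_gravitationally_evolved_state
    (f : Fin 2 → Fin 2 → ℝ)
    (ρ : Matrix (Fin 2 × Fin 2) (Fin 2 × Fin 2) ℂ)
    (hρ : ∀ a b a' b' : Fin 2,
      ρ (a, b) (a', b') = (1 / 4) * Complex.exp (Complex.I * ((f a b - f a' b' : ℝ) : ℂ)))
    (hH : (partialTransposeA ρ).IsHermitian) :
    ∑ i ∈ Finset.univ.filter (fun i => hH.eigenvalues i < 0), |hH.eigenvalues i|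
      = (1 / 2) * |Real.sin ((f 1 0 + f 0 1 - f 0 0 - f 1 1) / 2)| := by
  set θ := (f 1 0 + f 0 1 - f 0 0 - f 1 1) / 2 with hθ
  have hcp : (partialTransposeA ρ).charpoly =
      (Multiset.map (fun a : ℂ => Polynomial.X - Polynomial.C a)
        (Multiset.map (fun r : ℝ => (r : ℂ)) {(1 + Real.cos θ) / 2, (1 - Real.cos θ) / 2,
          Real.sin θ / 2, -(Real.sin θ / 2)})).prod := by
    apply Polynomial.funext
    intro x
    rw [Matrix.eval_charpoly,
      neg_aux_det (fun a b => Complex.exp (Complex.I * f a b))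
        (fun a b => Complex.exp (-(Complex.I * f a b))) _ x ((Real.sin θ : ℂ) ^ 2) _ _ ?_]
    · have hsc : (Real.sin θ : ℂ) ^ 2 + (Real.cos θ : ℂ) ^ 2 = 1 := by
        exact_mod_cast Real.sin_sq_add_cos_sq θ
      simp only [Multiset.insert_eq_cons, Multiset.map_cons, Multiset.map_singleton,
        Multiset.prod_cons, Multiset.prod_singleton, Polynomial.eval_mul, Polynomial.eval_sub,
        Polynomial.eval_X, Polynomial.eval_C]
      push_cast at hsc ⊢
      linear_combination (1 / 4) * (x ^ 2 - Complex.sin θ ^ 2 / 4) * hsc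
    · intro a b
      simp [← Complex.exp_add]
    · simp only [← Complex.exp_add]
      rw [Complex.ofReal_sin, Complex.sin_sq, Complex.cos_sq]
      have e : (2 * (θ : ℂ)) = f 1 0 + f 0 1 - f 0 0 - f 1 1 := by
        rw [hθ]; push_cast; ring
      rw [e, Complex.cos]
      have e1 : ((f 1 0 + f 0 1 - f 0 0 - f 1 1 : ℂ)) * Complex.I = Complex.I * f 1 0 + Complex.I * f 0 1
          + -(Complex.I * f 0 0) + -(Complex.I * f 1 1) := by ring
      have e2 : -((f 1 0 + f 0 1 - f 0 0 - f 1 1 : ℂ)) * Complex.I = -(Complex.I * f 1 0)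
          + -(Complex.I * f 0 1) + Complex.I * f 0 0 + Complex.I * f 1 1 := by ring
      rw [e1, e2]
      ring
    · intro a b a' b'
      simp only [partialTransposeA, hρ, ← Complex.exp_add]
      push_cast
      congr 2
      ring
  have hroots := congrArg Polynomial.roots hcp
  rw [Polynomial.roots_multiset_prod_X_sub_C, hH.roots_charpoly_eq_eigenvalues] at hroots
  have hm : Multiset.map hH.eigenvalues Finset.univ.val =
      {(1 + Real.cos θ) / 2, (1 - Real.cos θ) / 2, Real.sin θ / 2, -(Real.sin θ / 2)} := by
    apply Multiset.map_injective Complex.ofReal_injective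
    rw [Multiset.map_map]
    exact hroots
  have hsum := congrArg (fun m => (Multiset.map (fun x : ℝ => if x < 0 then |x| else 0) m).sum) hm
  simp only [Multiset.map_map] at hsum
  rw [Finset.sum_filter]
  refine Eq.trans hsum ?_
  simp only [Multiset.insert_eq_cons, Multiset.map_cons, Multiset.map_singleton,
    Multiset.sum_cons, Multiset.sum_singleton]
  have h1 := Real.cos_le_one θ
  have h2 := Real.neg_one_le_cos θ
  rw [if_neg (by linarith), if_neg (by linarith)]
  rcases lt_trichotomy (Real.sin θ) 0 with h | h | h
  · rw [if_pos (by linarith), if_neg (by linarith), abs_of_neg h, abs_of_neg (by linarith)]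
    ring
  · simp [h]
  · rw [if_neg (by linarith), if_pos (by linarith), abs_of_pos h, abs_of_neg (by linarith)]
    ring
end

section
/- Inseparability measure of the gravitational phase operation: let Φ_{LL}, Φ_{LR}, Φ_{RL}, Φ_{RR} be real numbers and let E be the 4×4 complex matrix indexed by (a,b) ∈ {L,R} × {L,R} with entries E_{(a,b),(a',b')} = exp(i(Φ_{ab} − Φ_{a'b'})). Then the sum of the absolute values of the negative eigenvalues of the partial transpose E^{T_A}, defined by (E^{T_A})_{(a,b),(a',b')} = E_{(a',b),(a,b')}, equals 2 · |sin((Φ_{LR} + Φ_{RL} − Φ_{LL} − Φ_{RR})/2)|. -/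
open Matrix BigOperators
open scoped ComplexOrder

theorem charpoly_aux (f : Fin 2 → Fin 2 → ℝ)
    (E : Matrix (Fin 2 × Fin 2) (Fin 2 × Fin 2) ℂ)
    (hE : ∀ a b a' b' : Fin 2,
      E (a, b) (a', b') = Complex.exp (Complex.I * ((f a b - f a' b' : ℝ) : ℂ)))
    (c s : ℝ) (hc : c = Real.cos ((f 0 1 + f 1 0 - f 0 0 - f 1 1) / 2))
    (hs : s = Real.sin ((f 0 1 + f 1 0 - f 0 0 - f 1 1) / 2)) :
    (partialTransposeA E).charpoly =
      (((({2 + 2 * c, 2 - 2 * c, 2 * s, -(2 * s)} : Multiset ℝ).map Complex.ofReal).map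
        (fun a => Polynomial.X - Polynomial.C a))).prod := by
  have hE' : ∀ a b a' b' : Fin 2, E (a, b) (a', b') =
      Complex.exp (Complex.I * (f a b : ℂ)) / Complex.exp (Complex.I * (f a' b' : ℂ)) := by
    intro a b a' b'
    rw [hE, ← Complex.exp_sub]
    push_cast
    ring_nf
  have hcs : (c : ℂ) ^ 2 + (s : ℂ) ^ 2 = 1 := by
    rw [hc, hs]
    exact_mod_cast Real.cos_sq_add_sin_sq _
  have hT : 4 * (s : ℂ) ^ 2 = 2 -
      Complex.exp (Complex.I * (f 0 1 : ℂ)) * Complex.exp (Complex.I * (f 1 0 : ℂ)) /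
        (Complex.exp (Complex.I * (f 0 0 : ℂ)) * Complex.exp (Complex.I * (f 1 1 : ℂ))) -
      Complex.exp (Complex.I * (f 0 0 : ℂ)) * Complex.exp (Complex.I * (f 1 1 : ℂ)) /
        (Complex.exp (Complex.I * (f 0 1 : ℂ)) * Complex.exp (Complex.I * (f 1 0 : ℂ))) := by
    rw [← Complex.exp_add, ← Complex.exp_add, ← Complex.exp_sub, ← Complex.exp_sub]
    have h1 : 4 * s ^ 2 = 2 - 2 * Real.cos (f 0 1 + f 1 0 - f 0 0 - f 1 1) := by
      have := Real.cos_sq' ((f 0 1 + f 1 0 - f 0 0 - f 1 1) / 2)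
      have h2 := Real.cos_sq ((f 0 1 + f 1 0 - f 0 0 - f 1 1) / 2)
      rw [mul_div_cancel₀ _ (two_ne_zero)] at h2
      rw [hs]; linarith
    have h2 : 4 * (s : ℂ) ^ 2 = 2 - 2 * Complex.cos ((f 0 1 + f 1 0 - f 0 0 - f 1 1 : ℝ) : ℂ) := by
      exact_mod_cast h1
    rw [h2, Complex.two_cos]
    push_cast
    ring_nf
  have n00 := Complex.exp_ne_zero (Complex.I * (f 0 0 : ℂ))
  have n01 := Complex.exp_ne_zero (Complex.I * (f 0 1 : ℂ))
  have n10 := Complex.exp_ne_zero (Complex.I * (f 1 0 : ℂ))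
  have n11 := Complex.exp_ne_zero (Complex.I * (f 1 1 : ℂ))
  apply Polynomial.funext
  intro z
  have hR : Polynomial.eval z (((({2 + 2 * c, 2 - 2 * c, 2 * s, -(2 * s)} : Multiset ℝ).map
      Complex.ofReal).map (fun a => Polynomial.X - Polynomial.C a))).prod =
      (z ^ 2 - 4 * z + 4 * (s : ℂ) ^ 2) * (z ^ 2 - 4 * (s : ℂ) ^ 2) := by
    simp
    linear_combination (-4) * (z ^ 2 - 4 * (s : ℂ) ^ 2) * hcs
  rw [hR, hT, Matrix.eval_charpoly, ← Matrix.det_reindex_self (finProdFinEquiv (m := 2) (n := 2))]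
  have e : ∀ M : Matrix (Fin 2 × Fin 2) (Fin 2 × Fin 2) ℂ,
      Matrix.reindex finProdFinEquiv finProdFinEquiv M =
      !![M (0,0) (0,0), M (0,0) (0,1), M (0,0) (1,0), M (0,0) (1,1);
         M (0,1) (0,0), M (0,1) (0,1), M (0,1) (1,0), M (0,1) (1,1);
         M (1,0) (0,0), M (1,0) (0,1), M (1,0) (1,0), M (1,0) (1,1);
         M (1,1) (0,0), M (1,1) (0,1), M (1,1) (1,0), M (1,1) (1,1)] := by
    intro M
    ext i j
    fin_cases i <;> fin_cases j <;> rfl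
  rw [e]
  simp only [Matrix.sub_apply, Matrix.scalar_apply, Matrix.diagonal_apply, partialTransposeA, hE']
  generalize Complex.exp (Complex.I * (f 0 0 : ℂ)) = p at *
  generalize Complex.exp (Complex.I * (f 0 1 : ℂ)) = q at *
  generalize Complex.exp (Complex.I * (f 1 0 : ℂ)) = r at *
  generalize Complex.exp (Complex.I * (f 1 1 : ℂ)) = t at *
  simp [Matrix.det_succ_row_zero, Fin.sum_univ_succ, Fin.succAbove, n00, n01, n10, n11]
  field_simp
  ring

/-- Inseparability measure of the gravitational phase operation. The
paths are labelled by `Fin 2` with `L = 0`, `R = 1`, and `Φ_{ab} = f a b`. For the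
matrix `E_{(a,b),(a',b')} = exp(i (Φ_{ab} - Φ_{a'b'}))`, the sum of the absolute
values of the negative eigenvalues of the partial transpose `E^{T_A}` equals
`2 |sin((Φ_{LR} + Φ_{RL} - Φ_{LL} - Φ_{RR})/2)|`. -/
theorem inseparability_measure_of_gravitational_phase_operation
    (f : Fin 2 → Fin 2 → ℝ)
    (E : Matrix (Fin 2 × Fin 2) (Fin 2 × Fin 2) ℂ)
    (hE : ∀ a b a' b' : Fin 2,
      E (a, b) (a', b') = Complex.exp (Complex.I * ((f a b - f a' b' : ℝ) : ℂ)))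
    (hH : (partialTransposeA E).IsHermitian) :
    ∑ i ∈ Finset.univ.filter (fun i => hH.eigenvalues i < 0), |hH.eigenvalues i|
      = 2 * |Real.sin ((f 0 1 + f 1 0 - f 0 0 - f 1 1) / 2)| := by
  set c := Real.cos ((f 0 1 + f 1 0 - f 0 0 - f 1 1) / 2) with hc
  set s := Real.sin ((f 0 1 + f 1 0 - f 0 0 - f 1 1) / 2) with hs
  have h1 := hH.roots_charpoly_eq_eigenvalues
  rw [charpoly_aux f E hE c s hc hs, Polynomial.roots_multiset_prod_X_sub_C,
    ← Multiset.map_map] at h1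
  have h2 : ({2 + 2 * c, 2 - 2 * c, 2 * s, -(2 * s)} : Multiset ℝ) =
      Multiset.map hH.eigenvalues Finset.univ.val :=
    Multiset.map_injective Complex.ofReal_injective h1
  have h3 : ∑ i ∈ Finset.univ.filter (fun i => hH.eigenvalues i < 0), |hH.eigenvalues i| =
      ((Multiset.map hH.eigenvalues Finset.univ.val).map
        (fun x => if x < 0 then |x| else 0)).sum := by
    rw [Finset.sum_filter, Multiset.map_map]
    rfl
  rw [h3, ← h2]
  have c1 : c ≤ 1 := Real.cos_le_one _
  have c2 : -1 ≤ c := Real.neg_one_le_cos _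
  have e1 : ¬ (2 + 2 * c < 0) := by linarith
  have e2 : ¬ (2 - 2 * c < 0) := by linarith
  simp only [Multiset.insert_eq_cons, Multiset.map_cons, Multiset.sum_cons,
    Multiset.map_singleton, Multiset.sum_singleton, if_neg e1, if_neg e2]
  rcases lt_trichotomy s 0 with h | h | h
  · rw [if_pos (by linarith), if_neg (by linarith), abs_mul]
    simp
  · simp [h]
  · rw [if_neg (by linarith), if_pos (by linarith), abs_neg, abs_mul]
    simp
end
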